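/- Let X be a local dendrite containing at least one simple closed curve, and let G be the core skeleton of X, i.e., the smallest subcontinuum of X containing every simple closed curve of X. Then X is homeomorphic to a subspace of ℝ² if and only if G is homeomorphic to a subspace of ℝ². -/

import Mathlib

open Topology

/-- A continuum: a nonempty compact connected metrizable topological space. -/
def IsContinuum (X : Type*) [TopologicalSpace X] : Prop :=
  Nonempty X ∧ CompactSpace X ∧ ConnectedSpace X ∧ TopologicalSpace.MetrizableSpace X

/-- A simple closed curve in `X`: a subspace homeomorphic to the circle. -/
def IsSimpleClosedCurve {X : Type*} [TopologicalSpace X] (S : Set X) : Prop :=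
  Nonempty (S ≃ₜ AddCircle (1 : ℝ))

/-- A dendrite: a locally connected continuum containing no simple closed curve. -/
def IsDendrite (X : Type*) [TopologicalSpace X] : Prop :=
  IsContinuum X ∧ LocallyConnectedSpace X ∧ ∀ S : Set X, ¬ IsSimpleClosedCurve S

/-- A local dendrite: a continuum each of whose points has a neighborhood
that is a dendrite. -/
def IsLocalDendrite (X : Type*) [TopologicalSpace X] : Prop :=
  IsContinuum X ∧ ∀ x : X, ∃ N : Set X, N ∈ 𝓝 x ∧ IsDendrite N

/-- A branch point of `X`: a point whose complement has at least three
connected components. -/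
def IsBranchPoint {X : Type*} [TopologicalSpace X] (x : X) : Prop :=
  ∃ u v w : ConnectedComponents (↥({x}ᶜ : Set X)), u ≠ v ∧ u ≠ w ∧ v ≠ w

/-- `X ∖ {x}` has countably infinitely many connected components
(i.e. there are ℵ₀ branches at `x`). -/
def HasAlephNullBranchesAt (X : Type*) [TopologicalSpace X] (x : X) : Prop :=
  Countable (ConnectedComponents (↥({x}ᶜ : Set X))) ∧
    Infinite (ConnectedComponents (↥({x}ᶜ : Set X)))


/-- The core skeleton of a local dendrite: the smallest subcontinuum containing every
simple closed curve. -/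
def IsCoreSkeleton {X : Type*} [TopologicalSpace X] (G : Set X) : Prop :=
  IsContinuum G ∧ (∀ S : Set X, IsSimpleClosedCurve S → S ⊆ G) ∧
  ∀ Y : Set X, IsContinuum Y → (∀ S : Set X, IsSimpleClosedCurve S → S ⊆ Y) → G ⊆ Y

section

open Set Metric

/-- `A` is an arc with end points `p` and `q`. -/
def IsArc {X : Type*} [TopologicalSpace X] (A : Set X) (p q : X) : Prop :=
  ∃ a : ℝ → X, ContinuousOn a (Icc 0 1) ∧ InjOn a (Icc 0 1) ∧ a 0 = p ∧ a 1 = q ∧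
    a '' Icc 0 1 = A

section Arc

variable {X : Type*} [TopologicalSpace X] {A B : Set X} {p q : X}

theorem IsArc.of_Icc {a : ℝ → X} {u v : ℝ} (huv : u < v) (hc : ContinuousOn a (Icc u v))
    (hi : InjOn a (Icc u v)) : IsArc (a '' Icc u v) (a u) (a v) := by
  have him : (fun t : ℝ => (v - u) * t + u) '' Icc 0 1 = Icc u v := by
    rw [image_affine_Icc' (by linarith)]; simp
  have hm : MapsTo (fun t : ℝ => (v - u) * t + u) (Icc 0 1) (Icc u v) := by
    rw [← him]; exact mapsTo_image _ _
  refine ⟨a ∘ fun t => (v - u) * t + u, hc.comp (by fun_prop) hm, hi.comp ?_ hm, by simp,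
    by simp, by rw [image_comp, him]⟩
  intro x _ y _ h
  have : (v - u) * x = (v - u) * y := by simpa using h
  exact mul_left_cancel₀ (by linarith) this

theorem IsArc.symm (h : IsArc A p q) : IsArc A q p := by
  obtain ⟨a, hc, hi, h0, h1, rfl⟩ := h
  have him : (fun t : ℝ => 1 - t) '' Icc 0 1 = Icc 0 1 := by simp
  have hm : MapsTo (fun t : ℝ => 1 - t) (Icc 0 1) (Icc 0 1) := by
    intro t ht; exact ⟨by linarith [ht.2], by linarith [ht.1]⟩
  refine ⟨a ∘ fun t => 1 - t, hc.comp (by fun_prop) hm, hi.comp ?_ hm, by simpa, by simpa,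
    by rw [image_comp, him]⟩
  intro x _ y _ h
  simpa using h

theorem IsArc.joinedIn (h : IsArc A p q) : JoinedIn A p q := by
  obtain ⟨a, hc, -, h0, h1, rfl⟩ := h
  exact JoinedIn.ofLine hc h0 h1 subset_rfl

theorem IsArc.left_mem (h : IsArc A p q) : p ∈ A := h.joinedIn.source_mem

theorem IsArc.right_mem (h : IsArc A p q) : q ∈ A := h.joinedIn.target_mem

theorem IsArc.ne (h : IsArc A p q) : p ≠ q := by
  obtain ⟨a, -, hi, rfl, rfl, -⟩ := h
  intro h
  have := hi (by simp) (by simp) h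
  norm_num at this

theorem IsArc.isCompact (h : IsArc A p q) : IsCompact A := by
  obtain ⟨a, hc, -, -, -, rfl⟩ := h
  exact isCompact_Icc.image_of_continuousOn hc

theorem IsArc.isSimpleClosedCurve_union [T2Space X] (hA : IsArc A p q) (hB : IsArc B p q)
    (hAB : A ∩ B ⊆ {p, q}) : IsSimpleClosedCurve (A ∪ B) := by
  have hpq := hA.ne
  obtain ⟨a, hac, hai, ha0, ha1, rfl⟩ := hA
  obtain ⟨b, hbc, hbi, hb0, hb1, rfl⟩ := hB
  set c : ℝ → X := fun t => if t ≤ 1 / 2 then a (2 * t) else b (2 - 2 * t) with hcdef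
  have hc1 : ∀ t, t ≤ 1 / 2 → c t = a (2 * t) := fun t ht => if_pos ht
  have hc2 : ∀ t, 1 / 2 ≤ t → c t = b (2 - 2 * t) := by
    intro t ht
    rcases ht.eq_or_lt with rfl | h
    · rw [hc1 _ le_rfl]; norm_num [ha1, hb1]
    · exact if_neg (not_le.2 h)
  have hcc : ContinuousOn c (Icc 0 1) := by
    have e : Icc (0 : ℝ) 1 = Icc 0 (1 / 2) ∪ Icc (1 / 2) 1 :=
      (Icc_union_Icc_eq_Icc (by norm_num) (by norm_num)).symm
    rw [e]
    refine ContinuousOn.union_of_isClosed ?_ ?_ isClosed_Icc isClosed_Icc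
    · refine ContinuousOn.congr (f := a ∘ fun t => 2 * t) (hac.comp (by fun_prop) ?_)
        (fun t ht => hc1 t ht.2)
      intro t ht; constructor <;> linarith [ht.1, ht.2]
    · refine ContinuousOn.congr (f := b ∘ fun t => 2 - 2 * t) (hbc.comp (by fun_prop) ?_)
        (fun t ht => hc2 t ht.1)
      intro t ht; constructor <;> linarith [ht.1, ht.2]
  have h01 : c 0 = c 1 := by
    rw [hc1 0 (by norm_num), hc2 1 (by norm_num)]; norm_num [ha0, hb0]
  have key : ∀ s t : ℝ, 0 ≤ s → s ≤ 1 / 2 → 1 / 2 < t → t < 1 → c s ≠ c t := by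
    intro s t hs hs' ht ht' h
    rw [hc1 s hs', hc2 t ht.le] at h
    have hs2 : 2 * s ∈ Icc (0 : ℝ) 1 := ⟨by linarith, by linarith⟩
    have ht2 : 2 - 2 * t ∈ Icc (0 : ℝ) 1 := ⟨by linarith, by linarith⟩
    have := hAB ⟨mem_image_of_mem a hs2, h ▸ mem_image_of_mem b ht2⟩
    rcases this with h' | h'
    · have := hbi ht2 (by simp) ((h.symm.trans h').trans hb0.symm); linarith
    · have := hbi ht2 (by simp) ((h.symm.trans h').trans hb1.symm); linarith
  have hci : InjOn c (Ico 0 1) := by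
    intro s hs t ht h
    rcases le_or_gt s (1 / 2) with h1 | h1 <;> rcases le_or_gt t (1 / 2) with h2 | h2
    · rw [hc1 s h1, hc1 t h2] at h
      have := hai ⟨by linarith [hs.1], by linarith⟩ ⟨by linarith [ht.1], by linarith⟩ h
      linarith
    · exact absurd h (key s t hs.1 h1 h2 ht.2)
    · exact absurd h.symm (key t s ht.1 h2 h1 hs.2)
    · rw [hc2 s h1.le, hc2 t h2.le] at h
      have := hbi ⟨by linarith [hs.2], by linarith⟩ ⟨by linarith [ht.2], by linarith⟩ h
      linarith
  have hfc : Continuous (AddCircle.liftIco (1 : ℝ) 0 c) :=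
    AddCircle.liftIco_zero_continuous h01 hcc
  have hsurj : ∀ x : AddCircle (1 : ℝ), ∃ t ∈ Ico (0 : ℝ) 1, (t : AddCircle (1 : ℝ)) = x := by
    intro x
    refine ⟨AddCircle.equivIco 1 0 x, by simpa using (AddCircle.equivIco (1 : ℝ) 0 x).2, ?_⟩
    exact AddCircle.coe_equivIco
  have hfi : Function.Injective (AddCircle.liftIco (1 : ℝ) 0 c) := by
    intro x y h
    obtain ⟨s, hs, rfl⟩ := hsurj x
    obtain ⟨t, ht, rfl⟩ := hsurj y
    rw [AddCircle.liftIco_zero_coe_apply hs, AddCircle.liftIco_zero_coe_apply ht] at h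
    rw [hci hs ht h]
  have hr : range (AddCircle.liftIco (1 : ℝ) 0 c) = a '' Icc 0 1 ∪ b '' Icc 0 1 := by
    apply Subset.antisymm
    · rintro _ ⟨x, rfl⟩
      obtain ⟨s, hs, rfl⟩ := hsurj x
      rw [AddCircle.liftIco_zero_coe_apply hs]
      rcases le_or_gt s (1 / 2) with h1 | h1
      · exact .inl ⟨2 * s, ⟨by linarith [hs.1], by linarith⟩, (hc1 s h1).symm⟩
      · exact .inr ⟨2 - 2 * s, ⟨by linarith [hs.2], by linarith⟩, (hc2 s h1.le).symm⟩
    · rintro _ (⟨s, hs, rfl⟩ | ⟨s, hs, rfl⟩)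
      · refine ⟨((s / 2 : ℝ) : AddCircle (1 : ℝ)), ?_⟩
        rw [AddCircle.liftIco_zero_coe_apply ⟨by linarith [hs.1], by linarith [hs.2]⟩,
          hc1 _ (by linarith [hs.2])]
        congr 1; ring
      · rcases hs.1.eq_or_lt with rfl | h0
        · refine ⟨((0 : ℝ) : AddCircle (1 : ℝ)), ?_⟩
          rw [AddCircle.liftIco_zero_coe_apply ⟨le_rfl, by norm_num⟩, hc1 _ (by norm_num)]
          simp [ha0, hb0]
        · refine ⟨((1 - s / 2 : ℝ) : AddCircle (1 : ℝ)), ?_⟩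
          rw [AddCircle.liftIco_zero_coe_apply ⟨by linarith [hs.2], by linarith⟩,
            hc2 _ (by linarith [hs.2])]
          congr 1; ring
  have : Fact ((0 : ℝ) < 1) := ⟨one_pos⟩
  have hemb := (hfc.isClosedEmbedding hfi).isEmbedding
  exact ⟨(hemb.toHomeomorph.trans (Homeomorph.setCongr hr)).symm⟩

end Arc

section PathToArc

variable {X : Type*} [MetricSpace X]

theorem continuousOn_infDist_image_Icc {γ : ℝ → X} (hγ : ContinuousOn γ (Icc 0 1)) (x : X) :
    ContinuousOn (fun t => infDist x (γ '' Icc 0 t)) (Icc 0 1) := by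
  have huc := isCompact_Icc.uniformContinuousOn_of_continuous hγ
  rw [Metric.uniformContinuousOn_iff] at huc
  have key : ∀ s t ε : ℝ, 0 ≤ s → s ≤ t → t ≤ 1 → (∀ u ∈ Icc s t, dist (γ u) (γ s) < ε) →
      dist (infDist x (γ '' Icc 0 s)) (infDist x (γ '' Icc 0 t)) ≤ ε := by
    intro s t ε hs hst ht h
    have hsub : Icc (0 : ℝ) t ⊆ Icc 0 1 := Icc_subset_Icc_right ht
    have hne : (γ '' Icc 0 s).Nonempty := ⟨γ s, s, ⟨hs, le_rfl⟩, rfl⟩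
    have h1 : infDist x (γ '' Icc 0 t) ≤ infDist x (γ '' Icc 0 s) :=
      infDist_le_infDist_of_subset (image_mono (Icc_subset_Icc_right hst)) hne
    obtain ⟨_, ⟨u, hu, rfl⟩, he⟩ := (isCompact_Icc.image_of_continuousOn
      (hγ.mono hsub)).exists_infDist_eq_dist (hne.mono (image_mono (Icc_subset_Icc_right hst))) x
    have hε : 0 < ε := dist_nonneg.trans_lt (h s ⟨le_rfl, hst⟩)
    rw [Real.dist_eq, abs_of_nonneg (by linarith), he]
    rcases le_total u s with hus | hus
    · have := infDist_le_dist_of_mem (x := x) (mem_image_of_mem γ (show u ∈ Icc 0 s from ⟨hu.1, hus⟩))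
      linarith
    · have := infDist_le_dist_of_mem (x := x) (mem_image_of_mem γ (show s ∈ Icc 0 s from ⟨hs, le_rfl⟩))
      have h3 := h u ⟨hus, hu.2⟩
      have h4 := dist_triangle x (γ u) (γ s)
      linarith
  rw [Metric.continuousOn_iff]
  intro t ht ε hε
  obtain ⟨δ, hδ, h⟩ := huc (ε / 2) (by linarith)
  refine ⟨δ, hδ, fun s hs hst => ?_⟩
  rw [Real.dist_eq, abs_lt] at hst
  rcases le_total s t with hle | hle
  · refine (key s t (ε / 2) hs.1 hle ht.2 fun u hu => h u ⟨hs.1.trans hu.1, hu.2.trans ht.2⟩ s hs ?_).trans_lt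
      (by linarith)
    rw [Real.dist_eq, abs_lt]; constructor <;> linarith [hu.1, hu.2]
  · rw [dist_comm]
    refine (key t s (ε / 2) ht.1 hle hs.2 fun u hu => h u ⟨ht.1.trans hu.1, hu.2.trans hs.2⟩ t ht ?_).trans_lt
      (by linarith)
    rw [Real.dist_eq, abs_lt]; constructor <;> linarith [hu.1, hu.2]

/-- A path all of whose fibres are intervals can be reparametrized to an arc. -/
theorem isArc_image_of_monotone [CompactSpace X] {γ : ℝ → X} (hγ : ContinuousOn γ (Icc 0 1))
    (hm : ∀ s t u, 0 ≤ s → s ≤ u → u ≤ t → t ≤ 1 → γ s = γ t → γ u = γ s) (hne : γ 0 ≠ γ 1) :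
    IsArc (γ '' Icc 0 1) (γ 0) (γ 1) := by
  have : Nonempty X := ⟨γ 0⟩
  let q := TopologicalSpace.denseSeq X
  let m : ℕ → ℝ → ℝ := fun n t => infDist (q n) (γ '' Icc 0 t)
  have hmb : ∀ n, ∀ t ∈ Icc (0 : ℝ) 1, ‖(1 / 2 : ℝ) ^ n * m n t‖ ≤ (1 / 2 : ℝ) ^ n * diam (univ : Set X) := by
    intro n t ht
    have h1 : m n t ≤ diam (univ : Set X) :=
      (infDist_le_dist_of_mem (mem_image_of_mem γ (show (0 : ℝ) ∈ Icc 0 t from ⟨le_rfl, ht.1⟩))).trans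
        (dist_le_diam_of_mem isCompact_univ.isBounded (mem_univ _) (mem_univ _))
    rw [Real.norm_of_nonneg (mul_nonneg (by positivity) infDist_nonneg)]
    gcongr
  have hsumb : Summable fun n : ℕ => (1 / 2 : ℝ) ^ n * diam (univ : Set X) :=
    summable_geometric_two.mul_right _
  let φ : ℝ → ℝ := fun t => ∑' n, (1 / 2 : ℝ) ^ n * m n t
  have hsum : ∀ t ∈ Icc (0 : ℝ) 1, Summable fun n => (1 / 2 : ℝ) ^ n * m n t := fun t ht =>
    Summable.of_norm_bounded hsumb fun n => hmb n t ht
  have hφc : ContinuousOn φ (Icc 0 1) :=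
    continuousOn_tsum (fun n => continuousOn_const.mul (continuousOn_infDist_image_Icc hγ _))
      hsumb hmb
  have hmle : ∀ n s t, 0 ≤ s → s ≤ t → m n t ≤ m n s := fun n s t hs hst =>
    infDist_le_infDist_of_subset (image_mono (Icc_subset_Icc_right hst)) ⟨γ s, s, ⟨hs, le_rfl⟩, rfl⟩
  have hφlt : ∀ s t, 0 ≤ s → s ≤ t → t ≤ 1 → γ s ≠ γ t → φ t < φ s := by
    intro s t hs hst ht hst'
    have hcs : IsCompact (γ '' Icc 0 s) :=
      isCompact_Icc.image_of_continuousOn (hγ.mono (Icc_subset_Icc_right (hst.trans ht)))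
    have hnot : γ t ∉ γ '' Icc 0 s := by
      rintro ⟨u, hu, hut⟩
      have := hm u t s hu.1 hu.2 hst ht hut
      exact hst' (this.trans hut)
    obtain ⟨r, hr, hball⟩ := Metric.isOpen_iff.1 hcs.isClosed.isOpen_compl _ hnot
    obtain ⟨n, hq⟩ := (TopologicalSpace.denseRange_denseSeq X).exists_mem_open
      (isOpen_ball (x := γ t) (ε := r / 2)) ⟨γ t, mem_ball_self (by linarith)⟩
    have hn : m n t < m n s := by
      have h1 : m n t ≤ dist (q n) (γ t) :=
        infDist_le_dist_of_mem (mem_image_of_mem γ ⟨hs.trans hst, le_rfl⟩)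
      have hq' : dist (q n) (γ t) < r / 2 := hq
      have h2 : r / 2 ≤ m n s := by
        refine (le_infDist (s := γ '' Icc 0 s) ⟨γ s, s, ⟨hs, le_rfl⟩, rfl⟩).2 fun y hy => ?_
        by_contra! hlt
        have : y ∈ ball (γ t) r := by
          rw [mem_ball']
          have := dist_triangle (γ t) (q n) y
          rw [dist_comm] at hq'
          linarith
        exact hball this hy
      linarith
    refine Summable.tsum_lt_tsum (i := n) (fun k => ?_) ?_ (hsum t ⟨hs.trans hst, ht⟩)
      (hsum s ⟨hs, hst.trans ht⟩)
    · exact mul_le_mul_of_nonneg_left (hmle k s t hs hst) (by positivity)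
    · exact mul_lt_mul_of_pos_left hn (by positivity)
  have hφeq' : ∀ s t, 0 ≤ s → s ≤ t → t ≤ 1 → γ s = γ t → φ s = φ t := by
    intro s t hs hst ht h
    have : γ '' Icc 0 s = γ '' Icc 0 t := by
      apply Subset.antisymm (image_mono (Icc_subset_Icc_right hst))
      rintro _ ⟨u, hu, rfl⟩
      rcases le_total u s with h1 | h1
      · exact ⟨u, ⟨hu.1, h1⟩, rfl⟩
      · exact ⟨s, ⟨hs, le_rfl⟩, (hm s t u hs h1 hu.2 ht h).symm⟩
    simp only [φ, m, this]
  have hφeq : ∀ s ∈ Icc (0 : ℝ) 1, ∀ t ∈ Icc (0 : ℝ) 1, (φ s = φ t ↔ γ s = γ t) := by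
    intro s hs t ht
    rcases le_total s t with h | h
    · exact ⟨fun he => by_contra fun hn => (hφlt s t hs.1 h ht.2 hn).ne' he,
        hφeq' s t hs.1 h ht.2⟩
    · exact ⟨fun he => by_contra fun hn => (hφlt t s ht.1 h hs.2 (Ne.symm hn)).ne he,
        fun he => (hφeq' t s ht.1 h hs.2 he.symm).symm⟩
  have hφanti : ∀ s t, 0 ≤ s → s ≤ t → t ≤ 1 → φ t ≤ φ s := by
    intro s t hs hst ht
    by_cases h : γ s = γ t
    · exact (hφeq' s t hs hst ht h).ge
    · exact (hφlt s t hs hst ht h).le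
  have him : φ '' Icc 0 1 = Icc (φ 1) (φ 0) := by
    apply Subset.antisymm
    · rintro _ ⟨t, ht, rfl⟩
      exact ⟨hφanti t 1 ht.1 ht.2 le_rfl, hφanti 0 t le_rfl ht.1 ht.2⟩
    · exact intermediate_value_Icc' zero_le_one hφc
  have hex : ∀ c : ℝ, ∃ t ∈ Icc (0 : ℝ) 1, c ∈ Icc (φ 1) (φ 0) → φ t = c := by
    intro c
    by_cases hc : c ∈ Icc (φ 1) (φ 0)
    · rw [← him] at hc
      obtain ⟨t, ht, h⟩ := hc
      exact ⟨t, ht, fun _ => h⟩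
    · exact ⟨0, by simp, fun h => absurd h hc⟩
  choose τ hτ hτφ using hex
  have hφmem : ∀ t ∈ Icc (0 : ℝ) 1, φ t ∈ Icc (φ 1) (φ 0) := fun t ht => him ▸ mem_image_of_mem φ ht
  have haφ : ∀ t ∈ Icc (0 : ℝ) 1, γ (τ (φ t)) = γ t := fun t ht =>
    (hφeq _ (hτ _) _ ht).1 (hτφ _ (hφmem t ht))
  have hac : ContinuousOn (fun c => γ (τ c)) (Icc (φ 1) (φ 0)) := by
    rw [continuousOn_iff_isClosed]
    intro C hC
    refine ⟨φ '' (Icc 0 1 ∩ γ ⁻¹' C), ?_, ?_⟩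
    · have : IsCompact (Icc 0 1 ∩ γ ⁻¹' C) :=
        isCompact_Icc.of_isClosed_subset (hγ.preimage_isClosed_of_isClosed isClosed_Icc hC)
          inter_subset_left
      exact (this.image_of_continuousOn (hφc.mono inter_subset_left)).isClosed
    · ext c
      constructor
      · rintro ⟨h1, h2⟩
        exact ⟨⟨τ c, ⟨hτ c, h1⟩, hτφ c h2⟩, h2⟩
      · rintro ⟨⟨t, ⟨ht, htC⟩, rfl⟩, h2⟩
        refine ⟨?_, h2⟩
        change γ (τ (φ t)) ∈ C
        rwa [haφ t ht]
  have hai : InjOn (fun c => γ (τ c)) (Icc (φ 1) (φ 0)) := by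
    intro c hc d hd h
    have := (hφeq _ (hτ c) _ (hτ d)).2 h
    rwa [hτφ c hc, hτφ d hd] at this
  have hlt := hφlt 0 1 le_rfl zero_le_one le_rfl hne
  have harc := (IsArc.of_Icc hlt hac hai).symm
  have hi2 : (fun c => γ (τ c)) '' Icc (φ 1) (φ 0) = γ '' Icc 0 1 := by
    rw [← him, image_image]
    exact image_congr haφ
  rw [hi2] at harc
  simpa only [haφ 0 (by simp), haφ 1 (by simp)] using harc

/-- The closed subsets of the unit interval that contain both end points and across whose gaps
`γ` takes equal values. -/
def gapEqualSets (γ : ℝ → X) : Set (Set ℝ) :=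
  {Z | IsClosed Z ∧ Z ⊆ Icc 0 1 ∧ 0 ∈ Z ∧ 1 ∈ Z ∧
    ∀ a ∈ Z, ∀ b ∈ Z, a < b → Ioo a b ∩ Z = ∅ → γ a = γ b}

theorem sInter_mem_gapEqualSets {γ : ℝ → X} (hγ : Continuous γ) {c : Set (Set ℝ)}
    (hc : c ⊆ gapEqualSets γ) (hchain : IsChain (· ⊆ ·) c) (hne : c.Nonempty) :
    ⋂₀ c ∈ gapEqualSets γ := by
  obtain ⟨Z₀, hZ₀⟩ := hne
  refine ⟨isClosed_sInter fun Z hZ => (hc hZ).1, (sInter_subset_of_mem hZ₀).trans (hc hZ₀).2.1,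
    fun Z hZ => (hc hZ).2.2.1, fun Z hZ => (hc hZ).2.2.2.1, fun a ha b hb hab hgap => ?_⟩
  refine eq_of_forall_dist_le fun ε hε => ?_
  obtain ⟨δ₁, hδ₁, h₁⟩ := Metric.continuousAt_iff.1 (hγ.continuousAt (x := a)) (ε / 2) (half_pos hε)
  obtain ⟨δ₂, hδ₂, h₂⟩ := Metric.continuousAt_iff.1 (hγ.continuousAt (x := b)) (ε / 2) (half_pos hε)
  obtain ⟨η, hη, hη1, hη2, hη3⟩ : ∃ η > 0, η < δ₁ ∧ η < δ₂ ∧ η < (b - a) / 2 := by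
    refine ⟨min δ₁ (min δ₂ ((b - a) / 2)) / 2, ?_, ?_, ?_, ?_⟩
    · have : 0 < min δ₁ (min δ₂ ((b - a) / 2)) := lt_min hδ₁ (lt_min hδ₂ (by linarith))
      linarith
    all_goals
      have : 0 < min δ₁ (min δ₂ ((b - a) / 2)) := lt_min hδ₁ (lt_min hδ₂ (by linarith))
      have h1 := min_le_left δ₁ (min δ₂ ((b - a) / 2))
      have h2 := min_le_right δ₁ (min δ₂ ((b - a) / 2))
      have h3 := min_le_left δ₂ ((b - a) / 2)
      have h4 := min_le_right δ₂ ((b - a) / 2)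
      linarith
  obtain ⟨Z, hZ, hZe⟩ : ∃ Z ∈ c, Icc (a + η) (b - η) ∩ Z = ∅ := by
    have : Nonempty c := ⟨⟨Z₀, hZ₀⟩⟩
    obtain ⟨Z, hZ⟩ := (isCompact_Icc (a := a + η) (b := b - η)).elim_directed_family_closed
      (fun Z : c => (Z : Set ℝ)) (fun Z => (hc Z.2).1) (by
        rw [← sInter_eq_iInter, ← subset_empty_iff, ← hgap]
        exact inter_subset_inter_left _ fun t ht => ⟨by linarith [ht.1], by linarith [ht.2]⟩)
      (fun Z W => (hchain.total Z.2 W.2).elim (fun h => ⟨Z, subset_rfl, h⟩) fun h => ⟨W, h, subset_rfl⟩)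
    exact ⟨Z, Z.2, hZ⟩
  obtain ⟨hZc, hZI, h0, h1, hZg⟩ := hc hZ
  have haZ : a ∈ Z := ha Z hZ
  have hbZ : b ∈ Z := hb Z hZ
  obtain ⟨a', ⟨ha'Z, ha'⟩, ha'm⟩ : ∃ a', IsGreatest (Z ∩ Icc a (a + η)) a' :=
    (isCompact_Icc.inter_left hZc).exists_isGreatest ⟨a, haZ, le_rfl, by linarith⟩
  obtain ⟨b', ⟨hb'Z, hb'⟩, hb'm⟩ : ∃ b', IsLeast (Z ∩ Icc (b - η) b) b' :=
    (isCompact_Icc.inter_left hZc).exists_isLeast ⟨b, hbZ, by linarith, le_rfl⟩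
  have hab' : γ a' = γ b' := by
    refine hZg a' ha'Z b' hb'Z (by linarith [ha'.2, hb'.1]) ?_
    ext t
    simp only [mem_inter_iff, mem_Ioo, mem_empty_iff_false, iff_false, not_and]
    rintro ⟨h1, h2⟩ htZ
    rcases le_or_gt t (a + η) with h | h
    · have := ha'm ⟨htZ, by linarith [ha'.1], h⟩
      linarith
    rcases le_or_gt (b - η) t with h' | h'
    · have := hb'm ⟨htZ, h', by linarith [hb'.2]⟩
      linarith
    have : t ∈ Icc (a + η) (b - η) ∩ Z := ⟨⟨h.le, h'.le⟩, htZ⟩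
    rw [hZe] at this
    exact this
  have e1 : dist (γ a') (γ a) < ε / 2 := h₁ (by
    rw [Real.dist_eq, abs_of_nonneg (by linarith [ha'.1])]; linarith [ha'.2])
  have e2 : dist (γ b') (γ b) < ε / 2 := h₂ (by
    rw [Real.dist_eq, abs_of_nonpos (by linarith [hb'.2])]; linarith [hb'.1])
  rw [← hab'] at e2
  have := dist_triangle_left (γ a) (γ b) (γ a')
  linarith

theorem exists_gapEqualSet_minimal {γ : ℝ → X} (hγ : Continuous γ) :
    ∃ Z ∈ gapEqualSets γ, ∀ x ∈ Z, ∀ y ∈ Z, x < y → γ x = γ y → Ioo x y ∩ Z = ∅ := by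
  have hI : Icc (0 : ℝ) 1 ∈ gapEqualSets γ := by
    refine ⟨isClosed_Icc, subset_rfl, by simp, by simp, fun a ha b hb hab h => ?_⟩
    have : (a + b) / 2 ∈ Ioo a b ∩ Icc 0 1 :=
      ⟨⟨by linarith, by linarith⟩, by linarith [ha.1, hb.1], by linarith [ha.2, hb.2]⟩
    rw [h] at this
    exact this.elim
  obtain ⟨Z, -, hZ⟩ := zorn_superset_nonempty (gapEqualSets γ)
    (fun c hc hchain hne => ⟨⋂₀ c, sInter_mem_gapEqualSets hγ hc hchain hne,
      fun s hs => sInter_subset_of_mem hs⟩) _ hI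
  obtain ⟨hZm, hZmin⟩ := hZ
  refine ⟨Z, hZm, fun x hx y hy hxy hγxy => ?_⟩
  obtain ⟨hZc, hZI, h0, h1, hZg⟩ := hZm
  have hZ' : Z \ Ioo x y ∈ gapEqualSets γ := by
    refine ⟨hZc.sdiff isOpen_Ioo, sdiff_subset.trans hZI,
      ⟨h0, fun h => by linarith [h.1, (hZI hx).1]⟩, ⟨h1, fun h => by linarith [h.2, (hZI hy).2]⟩, ?_⟩
    intro a ha b hb hab hgap
    by_cases hem : Ioo a b ∩ Z = ∅
    · exact hZg a ha.1 b hb.1 hab hem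
    obtain ⟨z, hz, hzZ⟩ := nonempty_iff_ne_empty.2 hem
    have hg : ∀ t ∈ Ioo a b, t ∈ Z → t ∈ Ioo x y := fun t ht htZ => by
      by_contra hn
      have : t ∈ Ioo a b ∩ (Z \ Ioo x y) := ⟨ht, htZ, hn⟩
      rw [hgap] at this
      exact this
    have hzxy := hg z hz hzZ
    have hax : a ≤ x := by
      by_contra! h
      exact ha.2 ⟨h, hz.1.trans hzxy.2⟩
    have hyb : y ≤ b := by
      by_contra! h
      exact hb.2 ⟨hzxy.1.trans hz.2, h⟩
    have hax' : a = x := by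
      by_contra hne
      exact lt_irrefl _ (hg x ⟨lt_of_le_of_ne hax hne, hzxy.1.trans hz.2⟩ hx).1
    have hyb' : y = b := by
      by_contra hne
      exact lt_irrefl _ (hg y ⟨hz.1.trans hzxy.2, lt_of_le_of_ne hyb hne⟩ hy).2
    rw [hax', ← hyb', hγxy]
  have := hZmin hZ' sdiff_subset
  ext t
  simp only [mem_inter_iff, mem_empty_iff_false, iff_false, not_and]
  exact fun ht htZ => (this htZ).2 ht

theorem exists_monotone_path {γ : ℝ → X} (hγ : Continuous γ) :
    ∃ γ' : ℝ → X, ContinuousOn γ' (Icc 0 1) ∧ γ' 0 = γ 0 ∧ γ' 1 = γ 1 ∧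
      γ' '' Icc 0 1 ⊆ γ '' Icc 0 1 ∧
      ∀ s t u, 0 ≤ s → s ≤ u → u ≤ t → t ≤ 1 → γ' s = γ' t → γ' u = γ' s := by
  obtain ⟨Z, ⟨hZc, hZI, h0, h1, hZg⟩, hZm⟩ := exists_gapEqualSet_minimal hγ
  have hex : ∀ t : ℝ, ∃ a, 0 ≤ t → IsGreatest (Z ∩ Icc 0 t) a := by
    intro t
    by_cases ht : 0 ≤ t
    · obtain ⟨a, ha⟩ := (isCompact_Icc.inter_left hZc).exists_isGreatest
        (⟨0, h0, le_rfl, ht⟩ : (Z ∩ Icc 0 t).Nonempty)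
      exact ⟨a, fun _ => ha⟩
    · exact ⟨0, fun h => absurd h ht⟩
  choose π hπ using hex
  have hπZ : ∀ t ∈ Z, π t = t := fun t ht =>
    le_antisymm (hπ t (hZI ht).1).1.2.2 ((hπ t (hZI ht).1).2 ⟨ht, (hZI ht).1, le_rfl⟩)
  have hπmono : ∀ s t, 0 ≤ s → s ≤ t → π s ≤ π t := fun s t hs hst =>
    (hπ t (hs.trans hst)).2 ⟨(hπ s hs).1.1, (hπ s hs).1.2.1, (hπ s hs).1.2.2.trans hst⟩
  refine ⟨fun t => γ (π t), ?_, by simp only [hπZ 0 h0], by simp only [hπZ 1 h1], ?_, ?_⟩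
  · rw [Metric.continuousOn_iff]
    intro t ht ε hε
    by_cases htZ : t ∈ Z
    · obtain ⟨δ, hδ, h⟩ := Metric.continuousAt_iff.1 (hγ.continuousAt (x := t)) ε hε
      obtain ⟨δ', hδ', hδδ', hleft⟩ : ∃ δ' > 0, δ' ≤ δ ∧ ∀ s, 0 ≤ s → t - δ' < s → s < t →
          dist (γ (π s)) (γ t) < ε := by
        by_cases hz : ∃ z ∈ Z, t - δ < z ∧ z < t
        · obtain ⟨z, hz, hz1, hz2⟩ := hz
          refine ⟨t - z, by linarith, by linarith, fun s hs hs1 hs2 => h ?_⟩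
          have e1 := hπmono z s (hZI hz).1 (by linarith)
          rw [hπZ z hz] at e1
          have e2 := (hπ s hs).1.2.2
          rw [Real.dist_eq, abs_lt]; constructor <;> linarith
        · push Not at hz
          refine ⟨δ, hδ, le_rfl, fun s hs hs1 hs2 => ?_⟩
          have e := hπ s hs
          rw [hZg (π s) e.1.1 t htZ (e.1.2.2.trans_lt hs2) ?_, dist_self]
          · exact hε
          · ext z
            simp only [mem_inter_iff, mem_Ioo, mem_empty_iff_false, iff_false, not_and]
            rintro ⟨h1, h2⟩ hzZ
            rcases le_or_gt z s with h3 | h3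
            · have := e.2 ⟨hzZ, (hZI hzZ).1, h3⟩
              linarith
            · exact absurd h2 (not_lt.2 (hz z hzZ (by linarith)))
      refine ⟨δ', hδ', fun s hs hst => ?_⟩
      simp only [hπZ t htZ]
      rw [Real.dist_eq, abs_lt] at hst
      rcases lt_or_ge s t with hlt | hge
      · exact hleft s hs.1 (by linarith) hlt
      · apply h
        have e1 := hπmono t s ht.1 hge
        rw [hπZ t htZ] at e1
        have e2 := (hπ s hs.1).1.2.2
        rw [Real.dist_eq, abs_lt]; constructor <;> linarith
    · obtain ⟨δ, hδ, h⟩ := Metric.isOpen_iff.1 hZc.isOpen_compl t htZ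
      refine ⟨δ, hδ, fun s hs hst => ?_⟩
      have hgap : ∀ z ∈ Z, z ≤ s ↔ z ≤ t := by
        intro z hz
        rw [Real.dist_eq, abs_lt] at hst
        have : ¬ (t - δ < z ∧ z < t + δ) := fun hn =>
          h (by rw [mem_ball, Real.dist_eq, abs_lt]; constructor <;> linarith [hn.1, hn.2]) hz
        constructor
        · intro h1; by_contra! h2; exact this ⟨by linarith, by linarith⟩
        · intro h1; by_contra! h2; exact this ⟨by linarith, by linarith⟩
      have : Z ∩ Icc 0 s = Z ∩ Icc 0 t := by
        ext z
        simp only [mem_inter_iff, mem_Icc]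
        exact ⟨fun ⟨a, b, c⟩ => ⟨a, b, (hgap z a).1 c⟩, fun ⟨a, b, c⟩ => ⟨a, b, (hgap z a).2 c⟩⟩
      have e1 := hπ s hs.1
      rw [this] at e1
      simp only [e1.unique (hπ t ht.1), dist_self]
      exact hε
  · rintro _ ⟨t, ht, rfl⟩
    exact ⟨π t, hZI (hπ t ht.1).1.1, rfl⟩
  · intro s t u hs hsu hut ht h
    have e1 := hπmono s u hs hsu
    have e2 := hπmono u t (hs.trans hsu) hut
    rcases (e1.trans e2).eq_or_lt with heq | hlt
    · simp only [le_antisymm (heq ▸ e2) e1]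
    · have := hZm _ (hπ s hs).1.1 _ (hπ t (hs.trans (hsu.trans hut))).1.1 hlt h
      rcases e1.eq_or_lt with h1 | h1
      · simp only [h1]
      rcases e2.eq_or_lt with h2 | h2
      · simp only [h2]; exact h.symm
      have hm : π u ∈ Ioo (π s) (π t) ∩ Z := ⟨⟨h1, h2⟩, (hπ u (hs.trans hsu)).1.1⟩
      rw [this] at hm
      exact hm.elim

theorem JoinedIn.exists_isArc [CompactSpace X] {E : Set X} {x y : X} (h : JoinedIn E x y)
    (hxy : x ≠ y) : ∃ A ⊆ E, IsArc A x y := by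
  obtain ⟨γ, hγ⟩ := h
  obtain ⟨γ', hc, h0, h1, hsub, hm⟩ := exists_monotone_path γ.continuous_extend
  rw [γ.extend_zero] at h0
  rw [γ.extend_one] at h1
  refine ⟨γ' '' Icc 0 1, hsub.trans ?_, ?_⟩
  · rintro _ ⟨t, ht, rfl⟩
    rw [γ.extend_apply ht]
    exact hγ _
  · have := isArc_image_of_monotone hc hm (by rwa [h0, h1])
    rwa [h0, h1] at this

end PathToArc

section LocallyConnected

variable {X : Type*} [MetricSpace X]

/-- `x` and `y` are joined by a chain of `N` steps of size less than `η` in `E`. -/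
def ChainIn (E : Set X) (η : ℝ) (N : ℕ) (x y : X) : Prop :=
  ∃ c : ℕ → X, c 0 = x ∧ (∀ j, N ≤ j → c j = y) ∧ (∀ j, c j ∈ E) ∧
    ∀ j, dist (c j) (c (j + 1)) < η

theorem ChainIn.mono {E E' : Set X} {η : ℝ} {N N' : ℕ} {x y : X} (h : ChainIn E η N x y)
    (hE : E ⊆ E') (hN : N ≤ N') : ChainIn E' η N' x y := by
  obtain ⟨c, h0, h1, h2, h3⟩ := h
  exact ⟨c, h0, fun j hj => h1 j (hN.trans hj), fun j => hE (h2 j), h3⟩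

theorem ChainIn.trans {E : Set X} {η : ℝ} {N M : ℕ} {x y z : X} (h : ChainIn E η N x y)
    (h' : ChainIn E η M y z) : ChainIn E η (N + M) x z := by
  obtain ⟨c, h0, h1, h2, h3⟩ := h
  obtain ⟨d, k0, k1, k2, k3⟩ := h'
  refine ⟨fun j => if j < N then c j else d (j - N), ?_, ?_, ?_, ?_⟩
  · rcases Nat.eq_zero_or_pos N with rfl | hN
    · simp [k0, ← h1 0 le_rfl, h0]
    · simp [hN, h0]
  · intro j hj
    simp only [not_lt.2 ((Nat.le_add_right N M).trans hj), if_false]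
    exact k1 _ (by omega)
  · intro j
    dsimp only
    split_ifs
    exacts [h2 _, k2 _]
  · intro j
    dsimp only
    by_cases hj : j + 1 < N
    · rw [if_pos hj, if_pos (by omega)]; exact h3 j
    by_cases hj' : j < N
    · have : j + 1 = N := by omega
      rw [if_neg hj, if_pos hj', this, Nat.sub_self, k0, ← h1 (j + 1) this.ge]
      exact h3 j
    · rw [if_neg hj, if_neg hj', Nat.sub_add_comm (by omega)]
      exact k3 _

theorem ChainIn.single {E : Set X} {η : ℝ} {x y : X} (hx : x ∈ E) (hy : y ∈ E)
    (h : dist x y < η) : ChainIn E η 1 x y := by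
  refine ⟨fun j => if j = 0 then x else y, by simp, fun j hj => if_neg (by omega), fun j => ?_,
    fun j => ?_⟩
  · dsimp only; split_ifs <;> assumption
  · dsimp only
    rw [if_neg (Nat.succ_ne_zero j)]
    split_ifs
    · exact h
    · simpa using dist_nonneg.trans_lt h

theorem IsPreconnected.exists_chainIn {E : Set X} (hE : IsPreconnected E) {η : ℝ} (hη : 0 < η)
    {x y : X} (hx : x ∈ E) (hy : y ∈ E) : ∃ N, ChainIn E η N x y := by
  refine hE.induction₂' (fun x y => ∃ N, ChainIn E η N x y) (fun z hz => ?_)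
    (fun a b c _ _ _ ⟨N, h⟩ ⟨M, k⟩ => ⟨N + M, h.trans k⟩) hx hy
  filter_upwards [inter_mem_nhdsWithin E (ball_mem_nhds z hη)] with w hw
  exact ⟨⟨1, .single hz hw.1 (mem_ball'.1 hw.2)⟩, ⟨1, .single hw.1 hz (mem_ball.1 hw.2)⟩⟩

variable [CompactSpace X] [LocallyConnectedSpace X]

theorem exists_isPreconnected_of_dist_lt {ε : ℝ} (hε : 0 < ε) :
    ∃ δ > 0, ∀ x y : X, dist x y < δ → ∃ E ⊆ ball x ε, IsPreconnected E ∧ x ∈ E ∧ y ∈ E := by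
  have h : ∀ z : X, ∃ V ⊆ ball z (ε / 2), IsOpen V ∧ z ∈ V ∧ IsConnected V := fun z =>
    locallyConnectedSpace_iff_subsets_isOpen_isConnected.1 inferInstance z _
      (ball_mem_nhds z (half_pos hε))
  choose V hVb hVo hzV hVc using h
  obtain ⟨δ, hδ, hL⟩ := lebesgue_number_lemma_of_metric (isCompact_univ (X := X)) hVo
    (fun z _ => mem_iUnion.2 ⟨z, hzV z⟩)
  refine ⟨δ, hδ, fun x y hxy => ?_⟩
  obtain ⟨z, hz⟩ := hL x (mem_univ x)
  have hx := hz (mem_ball_self hδ)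
  refine ⟨V z, fun w hw => ?_, (hVc z).isPreconnected, hx, hz (mem_ball'.2 hxy)⟩
  have h1 := mem_ball.1 (hVb z hw)
  have h2 := mem_ball'.1 (hVb z hx)
  exact mem_ball.2 ((dist_triangle w z x).trans_lt (by linarith))

theorem exists_uniform_chainIn {ε : ℝ} (hε : 0 < ε) :
    ∃ δ > 0, ∀ η > 0, ∃ N > 0, ∀ x y : X, dist x y < δ → ChainIn (ball x ε) η N x y := by
  obtain ⟨δ, hδ, h⟩ := exists_isPreconnected_of_dist_lt (X := X) (show 0 < ε / 3 by linarith)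
  refine ⟨min (δ / 4) ε, lt_min (by linarith) hε, fun η hη => ?_⟩
  have hr : 0 < min η (min (δ / 4) (ε / 3)) := lt_min hη (lt_min (by linarith) (by linarith))
  obtain ⟨t, htf, ht⟩ := Metric.totallyBounded_iff.1 (isCompact_univ (X := X)).totallyBounded _ hr
  have hnet : ∀ x : X, ∃ u ∈ t, dist x u < η ∧ dist x u < δ / 4 ∧ dist x u < ε / 3 := by
    intro x
    obtain ⟨u, hu, hxu⟩ := mem_iUnion₂.1 (ht (mem_univ x))
    have := mem_ball.1 hxu
    exact ⟨u, hu, this.trans_le (min_le_left _ _),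
      this.trans_le ((min_le_right _ _).trans (min_le_left _ _)),
      this.trans_le ((min_le_right _ _).trans (min_le_right _ _))⟩
  have hch : ∀ u v : X, ∃ N, dist u v < δ → ChainIn (ball u (ε / 3)) η N u v := by
    intro u v
    by_cases huv : dist u v < δ
    · obtain ⟨E, hEb, hE, hu, hv⟩ := h u v huv
      obtain ⟨N, hN⟩ := hE.exists_chainIn hη hu hv
      exact ⟨N, fun _ => hN.mono hEb le_rfl⟩
    · exact ⟨0, fun h => absurd h huv⟩
  choose N hN using hch
  obtain ⟨B, hB⟩ := ((htf.prod htf).image fun p : X × X => N p.1 p.2).bddAbove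
  refine ⟨1 + B + 1, by omega, fun x y hxy => ?_⟩
  obtain ⟨u, hu, hu1, hu2, hu3⟩ := hnet x
  obtain ⟨v, hv, hv1, hv2, hv3⟩ := hnet y
  have hxy1 := hxy.trans_le (min_le_left _ _)
  have hxy2 := hxy.trans_le (min_le_right _ _)
  have huv : dist u v < δ := by
    have h1 := dist_triangle4 u x y v
    rw [dist_comm u x] at h1
    linarith
  have hsub : ball u (ε / 3) ⊆ ball x ε := ball_subset_ball' (by rw [dist_comm]; linarith)
  have hc := (hN u v huv).mono hsub (hB ⟨(u, v), ⟨hu, hv⟩, rfl⟩)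
  obtain ⟨c, c0, c1, c2, -⟩ := id hc
  have hu' : u ∈ ball x ε := c0 ▸ c2 0
  have hv' : v ∈ ball x ε := c1 B le_rfl ▸ c2 B
  exact ((ChainIn.single (mem_ball_self hε) hu' hu1).trans hc).trans
    (.single hv' (mem_ball'.2 hxy2) (by rwa [dist_comm]))

theorem exists_joinedIn_ball_of_dist_lt {ε : ℝ} (hε : 0 < ε) :
    ∃ δ > 0, ∀ x y : X, dist x y < δ → JoinedIn (ball x ε) x y := by
  have hεn : ∀ n : ℕ, 0 < ε / 8 * (1 / 2 : ℝ) ^ n := fun n => by positivity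
  have h0 := fun n => exists_uniform_chainIn (X := X) (hεn n)
  choose δ' hδ' hN using h0
  let δ : ℕ → ℝ := fun n => min (δ' n) (ε / 8 * (1 / 2 : ℝ) ^ n)
  have hδ : ∀ n, 0 < δ n := fun n => lt_min (hδ' n) (hεn n)
  choose N hNpos hchain using fun n => hN n (δ (n + 1)) (hδ (n + 1))
  have hchain' : ∀ n (x y : X), ∃ c : ℕ → X, dist x y < δ n → c 0 = x ∧ c (N n) = y ∧
      (∀ j, dist (c j) x < ε / 8 * (1 / 2 : ℝ) ^ n) ∧ ∀ j, dist (c j) (c (j + 1)) < δ (n + 1) := by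
    intro n x y
    by_cases hxy : dist x y < δ n
    · obtain ⟨c, h1, h2, h3, h4⟩ := hchain n x y (hxy.trans_le (min_le_left _ _))
      exact ⟨c, fun _ => ⟨h1, h2 _ le_rfl, h3, h4⟩⟩
    · exact ⟨fun _ => x, fun h => absurd h hxy⟩
  choose c hc using hchain'
  refine ⟨δ 0, hδ 0, fun x y hxy => ?_⟩
  let γ : ℕ → ℕ → X := fun n => Nat.rec (fun i => if i = 0 then x else y)
    (fun n g m => c n (g (m / N n)) (g (m / N n + 1)) (m % N n)) n
  have hγ : ∀ n m, γ (n + 1) m = c n (γ n (m / N n)) (γ n (m / N n + 1)) (m % N n) :=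
    fun _ _ => rfl
  have hstep : ∀ n m, dist (γ n m) (γ n (m + 1)) < δ n := by
    intro n
    induction n with
    | zero =>
      intro m
      change dist (if m = 0 then x else y) (if m + 1 = 0 then x else y) < δ 0
      rw [if_neg (Nat.succ_ne_zero m)]
      split_ifs
      · exact hxy
      · rw [dist_self]; exact hδ 0
    | succ n ih =>
      intro m
      obtain ⟨h1, h2, h3, h4⟩ := hc n _ _ (ih (m / N n))
      have h5 := h4 (m % N n)
      rw [hγ, hγ]
      by_cases hm : m % N n + 1 = N n
      · rw [hm, h2] at h5
        have e1 : (m + 1) / N n = m / N n + 1 := by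
          have a1 := Nat.div_add_mod m (N n)
          exact Nat.div_eq_of_eq_mul_right (hNpos n) (by rw [Nat.mul_add]; omega)
        have e2 : (m + 1) % N n = 0 := by
          have a1 := Nat.div_add_mod m (N n)
          have a2 := Nat.div_add_mod (m + 1) (N n)
          rw [e1, Nat.mul_add] at a2
          omega
        rw [e1, e2, (hc n _ _ (ih (m / N n + 1))).1]
        exact h5
      · have hlt : m % N n + 1 < N n := lt_of_le_of_ne (Nat.mod_lt _ (hNpos n)) hm
        have e1 : (m + 1) / N n = m / N n := by
          rw [Nat.div_eq_iff (hNpos n)]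
          have a1 := Nat.div_add_mod m (N n)
          rw [Nat.mul_comm] at a1
          constructor <;> omega
        have e2 : (m + 1) % N n = m % N n + 1 := by
          have a1 := Nat.div_add_mod m (N n)
          have a2 := Nat.div_add_mod (m + 1) (N n)
          rw [e1] at a2
          omega
        rw [e1, e2]
        exact h5
  have hclose : ∀ n m, dist (γ (n + 1) m) (γ n (m / N n)) < ε / 8 * (1 / 2 : ℝ) ^ n := fun n m =>
    (hc n _ _ (hstep n (m / N n))).2.2.1 _
  let M : ℕ → ℕ := fun n => Nat.rec (motive := fun _ => ℕ) 1 (fun n k => k * N n) n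
  have hM : ∀ n, M (n + 1) = M n * N n := fun _ => rfl
  have hMpos : ∀ n, 0 < M n := by
    intro n
    induction n with
    | zero => exact one_pos
    | succ n ih => rw [hM]; exact Nat.mul_pos ih (hNpos n)
  let Γ : ℝ → ℕ → X := fun t n => γ n ⌊t * (M n : ℝ)⌋₊
  have hΓ : ∀ t n, dist (Γ t n) (Γ t (n + 1)) ≤ ε / 8 * (1 / 2 : ℝ) ^ n := by
    intro t n
    have : ⌊t * (M (n + 1) : ℝ)⌋₊ / N n = ⌊t * (M n : ℝ)⌋₊ := by
      rw [← Nat.floor_div_natCast, hM, Nat.cast_mul, ← mul_assoc, mul_div_cancel_right₀]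
      exact_mod_cast (hNpos n).ne'
    have h := hclose n ⌊t * (M (n + 1) : ℝ)⌋₊
    rw [this, dist_comm] at h
    exact h.le
  have hlim : ∀ t, ∃ l, Filter.Tendsto (Γ t) Filter.atTop (𝓝 l) := fun t =>
    cauchySeq_tendsto_of_complete (cauchySeq_of_le_geometric (1 / 2) (ε / 8) (by norm_num) (hΓ t))
  choose f hf using hlim
  have hfd : ∀ t n, dist (Γ t n) (f t) ≤ ε / 4 * (1 / 2 : ℝ) ^ n := by
    intro t n
    have := dist_le_of_le_geometric_of_tendsto (1 / 2) (ε / 8) (by norm_num) (hΓ t) (hf t) n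
    refine this.trans (le_of_eq ?_)
    ring
  have hfc : Continuous f := by
    rw [Metric.continuous_iff]
    intro t e he
    obtain ⟨n, hn⟩ := exists_pow_lt_of_lt_one (show 0 < e / ε by positivity) (show (1 / 2 : ℝ) < 1 by norm_num)
    have hn' : ε * (1 / 2 : ℝ) ^ n < e := by
      rw [lt_div_iff₀ hε] at hn; linarith
    have hMn : (0 : ℝ) < M n := by exact_mod_cast hMpos n
    refine ⟨1 / M n, by positivity, fun s hs => ?_⟩
    have hfl : ∀ a b : ℝ, a ≤ b → b - a < 1 / M n → dist (Γ a n) (Γ b n) ≤ δ n := by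
      intro a b hab hlt
      have h1 : ⌊a * M n⌋₊ ≤ ⌊b * M n⌋₊ := Nat.floor_le_floor (by gcongr)
      have h2 : ⌊b * M n⌋₊ ≤ ⌊a * M n⌋₊ + 1 := by
        rcases le_or_gt 0 (a * M n) with h0 | h0
        · rw [← Nat.floor_add_one h0]
          apply Nat.floor_le_floor
          rw [lt_div_iff₀ hMn] at hlt
          linarith
        · have : b * M n < 1 := by rw [lt_div_iff₀ hMn] at hlt; linarith
          rw [Nat.floor_eq_zero.2 this]; omega
      rcases h1.eq_or_lt with h | h
      · simp only [Γ, h, dist_self]; exact (hδ n).le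
      · have : ⌊b * M n⌋₊ = ⌊a * M n⌋₊ + 1 := by omega
        simp only [Γ, this]; exact (hstep n _).le
    have hd : dist (Γ s n) (Γ t n) ≤ δ n := by
      rw [Real.dist_eq, abs_lt] at hs
      rcases le_total s t with h | h
      · exact hfl s t h (by linarith)
      · rw [dist_comm]; exact hfl t s h (by linarith)
    have hd' : δ n ≤ ε / 8 * (1 / 2 : ℝ) ^ n := min_le_right _ _
    have := dist_triangle4 (f s) (Γ s n) (Γ t n) (f t)
    rw [dist_comm (f s) (Γ s n)] at this
    have h1 := hfd s n
    have h2 := hfd t n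
    have h3 := hεn n
    linarith
  have hΓ0 : ∀ n, Γ 0 n = x := by
    intro n
    simp only [Γ, zero_mul, Nat.floor_zero]
    induction n with
    | zero => rfl
    | succ n ih =>
      rw [hγ, Nat.zero_div, Nat.zero_mod, (hc n _ _ (hstep n 0)).1, ih]
  have hΓ1 : ∀ n, Γ 1 n = y := by
    intro n
    simp only [Γ, one_mul, Nat.floor_natCast]
    induction n with
    | zero => rfl
    | succ n ih =>
      rw [hγ, hM, Nat.mul_div_cancel _ (hNpos n), Nat.mul_mod_left, (hc n _ _ (hstep n _)).1, ih]
  have hf0 : f 0 = x := tendsto_nhds_unique (hf 0) (by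
    rw [show Γ 0 = fun _ => x from funext hΓ0]; exact tendsto_const_nhds)
  have hf1 : f 1 = y := tendsto_nhds_unique (hf 1) (by
    rw [show Γ 1 = fun _ => y from funext hΓ1]; exact tendsto_const_nhds)
  refine JoinedIn.ofLine hfc.continuousOn hf0 hf1 ?_
  rintro _ ⟨t, -, rfl⟩
  have h1 := hfd t 0
  have h2 : dist (Γ t 0) x < ε / 8 := by
    change dist (if _ = 0 then x else y) x < ε / 8
    split_ifs
    · rw [dist_self]; linarith
    · rw [dist_comm]
      have := hxy.trans_le (min_le_right _ _)
      simpa using this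
  rw [mem_ball]
  have := dist_triangle_left (f t) x (Γ t 0)
  rw [pow_zero] at h1
  linarith

end LocallyConnected

section

variable {X : Type*} [TopologicalSpace X]

theorem ContinuousOn.joinedIn_image_Icc {a : ℝ → X} {u v s t : ℝ} (h : ContinuousOn a (Icc u v))
    (hs : s ∈ Icc u v) (ht : t ∈ Icc u v) : JoinedIn (a '' Icc u v) (a s) (a t) :=
  ((convex_Icc u v).isPathConnected ⟨s, hs⟩ |>.image' h).joinedIn _ (mem_image_of_mem a hs) _
    (mem_image_of_mem a ht)

theorem IsArc.joinedIn_of_mem {A : Set X} {p q x y : X} (h : IsArc A p q) (hx : x ∈ A)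
    (hy : y ∈ A) : JoinedIn A x y := by
  obtain ⟨a, hc, hi, h0, h1, rfl⟩ := h
  obtain ⟨s, hs, rfl⟩ := hx
  obtain ⟨t, ht, rfl⟩ := hy
  exact hc.joinedIn_image_Icc hs ht

theorem IsArc.exists_mem_ne {A : Set X} {p q : X} (h : IsArc A p q) : ∃ x ∈ A, x ≠ p ∧ x ≠ q := by
  obtain ⟨a, hc, hi, rfl, rfl, rfl⟩ := h
  have h2 : (1 / 2 : ℝ) ∈ Icc (0 : ℝ) 1 := by constructor <;> norm_num
  refine ⟨a (1 / 2), mem_image_of_mem a h2, fun h => ?_, fun h => ?_⟩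
  · have := hi h2 (by simp) h; norm_num at this
  · have := hi h2 (by simp) h; norm_num at this

/-- A path ending in a closed set meets it for the first time at some point. -/
theorem JoinedIn.exists_first_hit {E K : Set X} {x y : X} (h : JoinedIn E x y) (hK : IsClosed K)
    (hy : y ∈ K) : ∃ z ∈ K, JoinedIn (E ∩ (Kᶜ ∪ {z})) x z := by
  obtain ⟨γ, hγ⟩ := h
  have hc : IsCompact ({t : ℝ | γ.extend t ∈ K} ∩ Icc 0 1) :=
    isCompact_Icc.inter_left (hK.preimage γ.continuous_extend)
  obtain ⟨t, ⟨ht, ht0, ht1⟩, hmin⟩ := hc.exists_isLeast ⟨1, by simpa using hy, by simp⟩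
  refine ⟨γ.extend t, ht, ?_⟩
  have hj := (γ.continuous_extend.continuousOn (s := Icc 0 t)).joinedIn_image_Icc
    (left_mem_Icc.2 ht0) (right_mem_Icc.2 ht0)
  rw [γ.extend_zero] at hj
  refine hj.mono ?_
  rintro _ ⟨s, hs, rfl⟩
  have hs1 : s ∈ Icc (0 : ℝ) 1 := ⟨hs.1, hs.2.trans ht1⟩
  refine ⟨by rw [γ.extend_apply hs1]; exact hγ _, ?_⟩
  rcases hs.2.eq_or_lt with h | h
  · right; rw [h]; rfl
  · left
    intro hsK
    exact absurd (hmin ⟨hsK, hs1⟩) (not_le.2 h)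

theorem JoinedIn.isPreconnected_superset {E : Set X} {x y : X} (h : JoinedIn E x y) :
    ∃ P ⊆ E, IsPreconnected P ∧ x ∈ P ∧ y ∈ P := by
  obtain ⟨γ, hγ⟩ := h
  exact ⟨range γ, range_subset_iff.2 hγ, isPreconnected_range γ.continuous, ⟨0, γ.source⟩,
    ⟨1, γ.target⟩⟩

theorem AddCircle.isPreconnected_compl_singleton (c : AddCircle (1 : ℝ)) :
    IsPreconnected ({c}ᶜ : Set (AddCircle (1 : ℝ))) := by
  obtain ⟨u, rfl⟩ := QuotientAddGroup.mk_surjective c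
  have : ({(u : AddCircle (1 : ℝ))}ᶜ : Set (AddCircle (1 : ℝ))) =
      (fun t : ℝ => (t : AddCircle (1 : ℝ))) '' Ioo u (u + 1) := by
    have : Fact ((0 : ℝ) < 1) := ⟨one_pos⟩
    ext x
    obtain ⟨t, ht, rfl⟩ : ∃ t ∈ Ico u (u + 1), (t : AddCircle (1 : ℝ)) = x := by
      have := AddCircle.coe_image_Ico_eq (1 : ℝ) u
      exact (this ▸ mem_univ x : x ∈ _ '' _)
    constructor
    · intro h
      refine ⟨t, ⟨lt_of_le_of_ne ht.1 ?_, ht.2⟩, rfl⟩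
      rintro rfl
      exact h rfl
    · rintro ⟨s, hs, hst⟩ h
      have h2 : (s : AddCircle (1 : ℝ)) = u := hst.trans h
      rw [AddCircle.coe_eq_coe_iff_of_mem_Ico (a := u) ⟨hs.1.le, hs.2⟩ ⟨le_rfl, by linarith⟩] at h2
      exact hs.1.ne' h2
  change IsPreconnected ({(u : AddCircle (1 : ℝ))}ᶜ : Set (AddCircle (1 : ℝ)))
  rw [this]
  exact isPreconnected_Ioo.image _ (AddCircle.continuous_mk' 1).continuousOn

theorem IsSimpleClosedCurve.isPreconnected_sdiff_singleton {S : Set X}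
    (hS : IsSimpleClosedCurve S) (h : X) : IsPreconnected (S \ {h}) := by
  obtain ⟨e⟩ := hS
  by_cases hh : h ∈ S
  · have : S \ {h} = (fun c => ((e.symm c : S) : X)) '' {e ⟨h, hh⟩}ᶜ := by
      ext x
      constructor
      · rintro ⟨hx, hne⟩
        refine ⟨e ⟨x, hx⟩, fun h' => hne ?_, by simp⟩
        simpa using h'
      · rintro ⟨c, hc, rfl⟩
        refine ⟨(e.symm c).2, fun h' => hc ?_⟩
        have : e.symm c = ⟨h, hh⟩ := Subtype.ext h'
        rw [← this]; simp
    rw [this]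
    exact (AddCircle.isPreconnected_compl_singleton _).image _
      (continuous_subtype_val.comp e.symm.continuous).continuousOn
  · rw [sdiff_singleton_eq_self hh]
    have : S = range (fun c => ((e.symm c : S) : X)) := by
      ext x
      exact ⟨fun hx => ⟨e ⟨x, hx⟩, by simp⟩, by rintro ⟨c, rfl⟩; exact (e.symm c).2⟩
    rw [this]
    exact isPreconnected_range (continuous_subtype_val.comp e.symm.continuous)

end

section

variable {X : Type*} [MetricSpace X] [CompactSpace X]

/-- A bridge over a set `K` together with a path in `K` gives a simple closed curve. -/
theorem exists_isSimpleClosedCurve_of_bridge {E K : Set X} {p q : X} (hpq : p ≠ q)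
    (h : JoinedIn (E ∩ (Kᶜ ∪ {p, q})) p q) (hK : JoinedIn (E ∩ K) p q) :
    ∃ S ⊆ E, IsSimpleClosedCurve S ∧ ¬ S ⊆ K := by
  obtain ⟨A, hAE, hA⟩ := h.exists_isArc hpq
  obtain ⟨B, hBE, hB⟩ := hK.exists_isArc hpq
  refine ⟨A ∪ B, union_subset (hAE.trans inter_subset_left) (hBE.trans inter_subset_left),
    hA.isSimpleClosedCurve_union hB ?_, fun hs => ?_⟩
  · rintro x ⟨hxA, hxB⟩
    exact (hAE hxA).2.resolve_left fun h => h (hBE hxB).2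
  · obtain ⟨x, hxA, h1, h2⟩ := hA.exists_mem_ne
    rcases (hAE hxA).2 with h | h | h
    · exact h (hs (Or.inl hxA))
    · exact h1 h
    · exact h2 h

/-- If points can be joined to `K` by paths of size `η` and `K` has no bridges of size `2 * η`,
then the first point at which such a path hits `K` defines a retraction onto `K`. -/
theorem exists_first_hit_retraction [LocallyConnectedSpace X] {K : Set X} (hK : IsClosed K)
    {η : ℝ} (hη : 0 < η)
    (hj : ∀ x, ∃ y ∈ K, JoinedIn (ball x η) x y)
    (hb : ∀ z, ∀ h ∈ K, ∀ h' ∈ K, JoinedIn (ball z (2 * η) ∩ (Kᶜ ∪ {h, h'})) h h' → h = h') :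
    ∃ r : X → X, Continuous r ∧ (∀ x, r x ∈ K) ∧
      (∀ x, JoinedIn (ball x η ∩ (Kᶜ ∪ {r x})) x (r x)) ∧
      (∀ x, ∀ h ∈ K, JoinedIn (ball x η ∩ (Kᶜ ∪ {h})) x h → h = r x) ∧
      (∀ x ∉ K, ∀ᶠ y in 𝓝 x, r y = r x) := by
  have hex : ∀ x, ∃ h ∈ K, JoinedIn (ball x η ∩ (Kᶜ ∪ {h})) x h := fun x => by
    obtain ⟨y, hy, h⟩ := hj x
    exact h.exists_first_hit hK hy
  choose r hrK hr using hex
  have huniq : ∀ x, ∀ h ∈ K, JoinedIn (ball x η ∩ (Kᶜ ∪ {h})) x h → h = r x := by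
    intro x h hh hx
    refine hb x h hh _ (hrK x) ((hx.symm.mono ?_).trans ((hr x).mono ?_))
    · exact inter_subset_inter (ball_subset_ball (by linarith))
        (union_subset_union_right _ (by simp))
    · exact inter_subset_inter (ball_subset_ball (by linarith))
        (union_subset_union_right _ (by simp))
  have hloc : ∀ x ∉ K, ∀ᶠ y in 𝓝 x, r y = r x := by
    intro x hx
    obtain ⟨e, he, hball⟩ := Metric.isOpen_iff.1 hK.isOpen_compl x hx
    obtain ⟨δ, hδ, hd⟩ := exists_joinedIn_ball_of_dist_lt (X := X) (lt_min he hη)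
    filter_upwards [ball_mem_nhds x (lt_min hδ hη)] with y hy
    have hy' := mem_ball'.1 hy
    have hxy := hd x y (hy'.trans_le (min_le_left _ _))
    refine hb x _ (hrK y) _ (hrK x)
      (((hr y).symm.mono ?_).trans ((hxy.symm.mono ?_).trans ((hr x).mono ?_)))
    · exact inter_subset_inter
        (ball_subset_ball' (by linarith [mem_ball.1 hy, min_le_right δ η]))
        (union_subset_union_right _ (by simp))
    · intro w hw
      refine ⟨mem_ball.2 ((mem_ball.1 hw).trans_le ((min_le_right _ _).trans (by linarith))), ?_⟩
      exact Or.inl (hball (ball_subset_ball (min_le_left _ _) hw))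
    · exact inter_subset_inter (ball_subset_ball (by linarith))
        (union_subset_union_right _ (by simp))
  have hid : ∀ x ∈ K, r x = x := fun x hx =>
    (huniq x x hx (JoinedIn.refl ⟨mem_ball_self hη, Or.inr rfl⟩)).symm
  refine ⟨r, continuous_iff_continuousAt.2 fun x => ?_, hrK, hr, huniq, hloc⟩
  by_cases hx : x ∈ K
  · rw [Metric.continuousAt_iff']
    intro e he
    have he' : 0 < min e (η / 2) := lt_min he (half_pos hη)
    obtain ⟨δ, hδ, hd⟩ := exists_joinedIn_ball_of_dist_lt (X := X) he'
    filter_upwards [ball_mem_nhds x (lt_min hδ (half_pos hη))] with y hy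
    have hy' := mem_ball'.1 hy
    obtain ⟨h, hh, hyh⟩ := (hd x y (hy'.trans_le (min_le_left _ _))).symm.exists_first_hit hK hx
    have hbb : ball x (min e (η / 2)) ⊆ ball y η := ball_subset_ball' (by
      linarith [min_le_right e (η / 2), min_le_right δ (η / 2)])
    have := huniq y h hh (hyh.mono (inter_subset_inter_left _ hbb))
    rw [hid x hx, ← this]
    exact (mem_ball.1 hyh.target_mem.1).trans_le (min_le_left _ _)
  · exact continuousAt_const.congr ((hloc x hx).mono fun y hy => hy.symm)

end

section

variable {X : Type*} [MetricSpace X]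

/-- Simple closed curves lie in a retract as above, if none of them is small. -/
theorem IsSimpleClosedCurve.subset_of_retraction {K : Set X} (hK : IsClosed K) {r : X → X}
    (hr : Continuous r) {η : ℝ} (hrK : ∀ x, r x ∈ K) (hid : ∀ x ∈ K, r x = x)
    (hd : ∀ x, dist x (r x) < η)
    (hloc : ∀ x ∉ K, ∀ᶠ y in 𝓝 x, r y = r x) {S : Set X} (hS : IsSimpleClosedCurve S)
    (hsmall : ∀ x, ¬ S ⊆ ball x η) : S ⊆ K := by
  intro s hs
  by_contra hsK
  apply hsmall (r s)
  have hfib : S \ {r s} ⊆ {x | x ∉ K ∧ r x = r s} := by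
    have hopen : IsOpen {x | x ∉ K ∧ r x = r s} := by
      rw [isOpen_iff_mem_nhds]
      rintro x ⟨hx, hxs⟩
      filter_upwards [hloc x hx, hK.isOpen_compl.mem_nhds hx] with y hy hyK
      exact ⟨hyK, hy.trans hxs⟩
    refine (hS.isPreconnected_sdiff_singleton (r s)).subset_left_of_subset_union hopen
      (isOpen_compl_singleton.preimage hr : IsOpen (r ⁻¹' {r s}ᶜ)) ?_ ?_ ?_
    · exact disjoint_left.2 fun x hx hx' => hx' hx.2
    · rintro x ⟨-, hx⟩
      by_cases h : r x = r s
      · exact Or.inl ⟨fun hxK => hx ((hid x hxK).symm.trans h), h⟩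
      · exact Or.inr h
    · exact ⟨s, ⟨hs, fun h => hsK (by rw [mem_singleton_iff.1 h]; exact hrK s)⟩, hsK, rfl⟩
  intro x hx
  by_cases hxs : x = r s
  · rw [hxs]; exact mem_ball_self (dist_nonneg.trans_lt (hd x))
  · have := (hfib ⟨hx, hxs⟩).2
    rw [mem_ball, ← this]
    exact hd x

end

section

variable {X : Type*} [TopologicalSpace X]

/-- A parametrized arc starting at `p`. -/
def IsRay (a : ℝ → X) (p : X) : Prop :=
  ContinuousOn a (Icc 0 1) ∧ InjOn a (Icc 0 1) ∧ a 0 = p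

/-- A finite family of arcs in `K` that start at `p` and meet only there. -/
def IsStarFamily (T : Set (ℝ → X)) (p : X) (K : Set X) : Prop :=
  T.Finite ∧ (∀ a ∈ T, IsRay a p ∧ a '' Icc 0 1 ⊆ K) ∧
    T.Pairwise fun a b => a '' Icc 0 1 ∩ b '' Icc 0 1 ⊆ {p}

/-- Near `p`, the set `K` is contained in the union of a star family in `K`. -/
def StarAt (K : Set X) (p : X) : Prop :=
  ∃ T, IsStarFamily T p K ∧ ∃ U, IsOpen U ∧ p ∈ U ∧ U ∩ K ⊆ {p} ∪ ⋃ a ∈ T, a '' Icc 0 1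

variable {a b : ℝ → X} {p : X}

theorem IsRay.isArc (h : IsRay a p) : IsArc (a '' Icc 0 1) p (a 1) :=
  ⟨a, h.1, h.2.1, h.2.2, rfl, rfl⟩

theorem IsArc.exists_isRay {A : Set X} {p q : X} (h : IsArc A p q) :
    ∃ a, IsRay a p ∧ a 1 = q ∧ a '' Icc 0 1 = A := by
  obtain ⟨a, hc, hi, h0, h1, hA⟩ := h
  exact ⟨a, ⟨hc, hi, h0⟩, h1, hA⟩

theorem IsRay.continuousOn_Icc (h : IsRay a p) {u v : ℝ} (hu : 0 ≤ u) (hv : v ≤ 1) :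
    ContinuousOn a (Icc u v) := h.1.mono (Icc_subset_Icc hu hv)

theorem IsRay.isCompact_image_Icc (h : IsRay a p) {u v : ℝ} (hu : 0 ≤ u) (hv : v ≤ 1) :
    IsCompact (a '' Icc u v) := isCompact_Icc.image_of_continuousOn (h.continuousOn_Icc hu hv)

theorem IsRay.mem_image (h : IsRay a p) : p ∈ a '' Icc 0 1 :=
  ⟨0, by simp, h.2.2⟩

theorem IsRay.mem_image_Icc_iff (h : IsRay a p) {u v t : ℝ} (hu : 0 ≤ u) (hv : v ≤ 1)
    (ht : t ∈ Icc (0 : ℝ) 1) : a t ∈ a '' Icc u v ↔ t ∈ Icc u v := by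
  refine ⟨?_, mem_image_of_mem a⟩
  rintro ⟨s, hs, hst⟩
  rwa [← h.2.1 ⟨hu.trans hs.1, hs.2.trans hv⟩ ht hst]

theorem IsRay.notMem_image_Icc (h : IsRay a p) {s : ℝ} (hs : 0 < s) : p ∉ a '' Icc s 1 := by
  rw [← h.2.2, h.mem_image_Icc_iff hs.le le_rfl (by simp)]
  exact fun h => hs.not_ge h.1

theorem image_mul_left_Icc_zero_one {X : Type*} (a : ℝ → X) {s : ℝ} (hs : 0 < s) :
    (fun t => a (s * t)) '' Icc 0 1 = a '' Icc 0 s := by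
  have : (fun t => a (s * t)) = a ∘ (s * ·) := rfl
  rw [this, image_comp, image_mul_left_Icc' hs, mul_zero, mul_one]

theorem IsRay.comp_mul (h : IsRay a p) {s : ℝ} (hs : 0 < s) (hs1 : s ≤ 1) :
    IsRay (fun t => a (s * t)) p := by
  have hm : MapsTo (fun t : ℝ => s * t) (Icc 0 1) (Icc 0 1) := fun t ht =>
    ⟨mul_nonneg hs.le ht.1, mul_le_one₀ hs1 ht.1 ht.2⟩
  refine ⟨h.1.comp (by fun_prop) hm, fun t ht u hu htu => ?_, by simp [h.2.2]⟩
  exact mul_left_cancel₀ hs.ne' (h.2.1 (hm ht) (hm hu) htu)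

theorem IsArc.exists_isStarFamily {A : Set X} {u v : X} (h : IsArc A u v) (hp : p ∈ A) :
    ∃ T, IsStarFamily T p A ∧ A ⊆ {p} ∪ ⋃ a ∈ T, a '' Icc 0 1 := by
  obtain ⟨a, hc, hi, -, -, rfl⟩ := h
  obtain ⟨s, hs, rfl⟩ := hp
  have hback : 0 < s → IsRay (fun t => a (s * (1 - t))) (a s) ∧
      (fun t => a (s * (1 - t))) '' Icc 0 1 = a '' Icc 0 s := by
    intro h0
    have hm : MapsTo (fun t : ℝ => s * (1 - t)) (Icc 0 1) (Icc 0 1) := fun t ht =>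
      ⟨mul_nonneg hs.1 (by linarith [ht.2]), mul_le_one₀ hs.2 (by linarith [ht.2])
        (by linarith [ht.1])⟩
    refine ⟨⟨hc.comp (by fun_prop) hm, fun t ht u hu htu => ?_, by simp⟩, ?_⟩
    · have := mul_left_cancel₀ h0.ne' (hi (hm ht) (hm hu) htu)
      linarith
    · have : (fun t => a (s * (1 - t))) = (fun t => a (s * t)) ∘ (1 - ·) := rfl
      rw [this, image_comp, image_const_sub_Icc, sub_self, sub_zero,
        image_mul_left_Icc_zero_one a h0]
  have hfwd : s < 1 → IsRay (fun t => a ((1 - s) * t + s)) (a s) ∧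
      (fun t => a ((1 - s) * t + s)) '' Icc 0 1 = a '' Icc s 1 := by
    intro h1
    have hm : MapsTo (fun t : ℝ => (1 - s) * t + s) (Icc 0 1) (Icc 0 1) := fun t ht =>
      ⟨by have := mul_nonneg (sub_nonneg.2 hs.2) ht.1; linarith [hs.1],
        by have := mul_le_mul_of_nonneg_left ht.2 (sub_nonneg.2 hs.2); linarith⟩
    refine ⟨⟨hc.comp (by fun_prop) hm, fun t ht u hu htu => ?_, by simp⟩, ?_⟩
    · exact mul_left_cancel₀ (sub_pos.2 h1).ne' (by linarith [hi (hm ht) (hm hu) htu])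
    · have : (fun t => a ((1 - s) * t + s)) = a ∘ (fun t => (1 - s) * t + s) := rfl
      rw [this, image_comp, image_affine_Icc' (sub_pos.2 h1)]
      simp
  have hsub1 : a '' Icc 0 s ⊆ a '' Icc 0 1 := image_mono (Icc_subset_Icc_right hs.2)
  have hsub2 : a '' Icc s 1 ⊆ a '' Icc 0 1 := image_mono (Icc_subset_Icc_left hs.1)
  have hmeet : a '' Icc 0 s ∩ a '' Icc s 1 ⊆ {a s} := by
    rw [← hi.image_inter (Icc_subset_Icc_right hs.2) (Icc_subset_Icc_left hs.1),
      Icc_inter_Icc_eq_singleton hs.1 hs.2, image_singleton]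
  have hcov : a '' Icc 0 1 = a '' Icc 0 s ∪ a '' Icc s 1 := by
    rw [← image_union, Icc_union_Icc_eq_Icc hs.1 hs.2]
  rcases hs.1.eq_or_lt with h0 | h0
  · have h1 : s < 1 := by linarith
    refine ⟨{fun t => a ((1 - s) * t + s)}, ⟨finite_singleton _, ?_, pairwise_singleton _ _⟩, ?_⟩
    · rintro _ rfl
      exact ⟨(hfwd h1).1, (hfwd h1).2.trans_subset hsub2⟩
    · rw [biUnion_singleton, (hfwd h1).2, ← h0]
      exact subset_union_right
  rcases hs.2.eq_or_lt with h1 | h1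
  · refine ⟨{fun t => a (s * (1 - t))}, ⟨finite_singleton _, ?_, pairwise_singleton _ _⟩, ?_⟩
    · rintro _ rfl
      exact ⟨(hback h0).1, (hback h0).2.trans_subset hsub1⟩
    · rw [biUnion_singleton, (hback h0).2, h1]
      exact subset_union_right
  · refine ⟨{fun t => a ((1 - s) * t + s), fun t => a (s * (1 - t))}, ⟨by simp, ?_, ?_⟩, ?_⟩
    · rintro _ (rfl | rfl)
      · exact ⟨(hfwd h1).1, (hfwd h1).2.trans_subset hsub2⟩
      · exact ⟨(hback h0).1, (hback h0).2.trans_subset hsub1⟩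
    · refine pairwise_pair.2 fun _ => ⟨?_, ?_⟩
      · rw [(hfwd h1).2, (hback h0).2, inter_comm]; exact hmeet
      · rw [(hfwd h1).2, (hback h0).2]; exact hmeet
    · rw [biUnion_pair, (hfwd h1).2, (hback h0).2, union_comm (a '' Icc s 1), ← hcov]
      exact subset_union_right

theorem exists_isOpen_avoiding_tails [T2Space X] {T : Set (ℝ → X)} (hT : T.Finite)
    (hr : ∀ a ∈ T, IsRay a p) {s : (ℝ → X) → ℝ} (hs : ∀ a ∈ T, 0 < s a) {U : Set X}
    (hU : IsOpen U) (hp : p ∈ U) :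
    ∃ V ⊆ U, IsOpen V ∧ p ∈ V ∧ ∀ x ∈ V, ∀ a ∈ T, x ∉ a '' Icc (s a) 1 := by
  refine ⟨U \ ⋃ a ∈ T, a '' Icc (s a) 1, sdiff_subset, hU.sdiff ?_, ⟨hp, ?_⟩, ?_⟩
  · exact hT.isClosed_biUnion fun a ha =>
      ((hr a ha).isCompact_image_Icc (hs a ha).le le_rfl).isClosed
  · simp only [mem_iUnion, not_exists]
    exact fun a ha => (hr a ha).notMem_image_Icc (hs a ha)
  · intro x hx a ha hxa
    exact hx.2 (mem_biUnion ha hxa)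

theorem mem_image_of_notMem_image_tail {X : Type*} {a : ℝ → X} {s : ℝ} {x : X} (hx : x ∈ a '' Icc 0 1)
    (hs : x ∉ a '' Icc s 1) : ∃ t, 0 ≤ t ∧ t < s ∧ t ≤ 1 ∧ a t = x := by
  obtain ⟨t, ht, rfl⟩ := hx
  exact ⟨t, ht.1, lt_of_not_ge fun h => hs ⟨t, ⟨h, ht.2⟩, rfl⟩, ht.2, rfl⟩

/-- A connected subset of a star is a star. -/
theorem StarAt.mono [T2Space X] {H G : Set X} (hH : StarAt H p) (hGH : G ⊆ H) (hG : IsPreconnected G)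
    (hp : p ∈ G) : StarAt G p := by
  obtain ⟨T, ⟨hTf, hTr, hTp⟩, U, hU, hpU, hUH⟩ := hH
  have key : ∀ a ∈ T, ∃ s, 0 < s ∧ s ≤ 1 ∧
      (a '' Icc 0 s ⊆ G ∨ ∀ t, 0 < t → t < s → a t ∉ G) := by
    intro a ha
    obtain ⟨hra, haH⟩ := hTr a ha
    by_contra! hcon
    obtain ⟨s₀, hs₀, hs₀1, hs₀U⟩ : ∃ s, 0 < s ∧ s ≤ 1 ∧ a '' Icc 0 s ⊆ U := by
      have : ∀ᶠ t in 𝓝[Icc 0 1] (0 : ℝ), a t ∈ U :=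
        hra.1 0 (by simp) (hU.mem_nhds (by rwa [hra.2.2]))
      rw [eventually_nhdsWithin_iff, Metric.eventually_nhds_iff] at this
      obtain ⟨e, he, h⟩ := this
      refine ⟨min (e / 2) 1, by positivity, min_le_right _ _, ?_⟩
      rintro _ ⟨t, ht, rfl⟩
      refine h ?_ ⟨ht.1, ht.2.trans (min_le_right _ _)⟩
      rw [Real.dist_eq, sub_zero, abs_of_nonneg ht.1]
      exact (ht.2.trans (min_le_left _ _)).trans_lt (by linarith)
    have hout : ∀ s, 0 < s → s ≤ s₀ → ∃ t, 0 < t ∧ t ≤ s ∧ a t ∉ G := by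
      intro s hs hss
      obtain ⟨h, -⟩ := hcon s hs (hss.trans hs₀1)
      obtain ⟨_, ⟨t, ht, rfl⟩, htG⟩ := not_subset.1 h
      refine ⟨t, lt_of_le_of_ne ht.1 ?_, ht.2, htG⟩
      rintro rfl
      exact htG (by rwa [hra.2.2])
    obtain ⟨s₁, hs₁, hs₁0, hs₁G⟩ := hout s₀ hs₀ le_rfl
    obtain ⟨-, t, ht, hts, htG⟩ := hcon s₁ hs₁ (hs₁0.trans hs₀1)
    obtain ⟨s₂, hs₂, hs₂t, hs₂G⟩ := hout t ht (hts.le.trans hs₁0)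
    have hs₁1 : s₁ ≤ 1 := hs₁0.trans hs₀1
    have hne : s₂ < t := lt_of_le_of_ne hs₂t (by rintro rfl; exact hs₂G htG)
    let C := a '' Icc s₂ s₁
    have hCc : IsClosed C := (hra.isCompact_image_Icc hs₂.le hs₁1).isClosed
    let D := (⋃ b ∈ T \ {a}, b '' Icc 0 1) ∪ a '' Icc 0 s₂ ∪ a '' Icc s₁ 1 ∪ Uᶜ
    have hDc : IsClosed D := by
      refine ((IsClosed.union ?_ ?_).union ?_).union hU.isClosed_compl
      · exact (hTf.subset sdiff_subset).isClosed_biUnion fun b hb =>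
          ((hTr b hb.1).1.isCompact_image_Icc le_rfl le_rfl).isClosed
      · exact (hra.isCompact_image_Icc le_rfl (hs₂t.trans (hts.le.trans hs₁1))).isClosed
      · exact (hra.isCompact_image_Icc hs₁.le le_rfl).isClosed
    have hcov : G ⊆ C ∪ D := by
      intro x hx
      by_cases hxU : x ∈ U
      swap
      · exact Or.inr (Or.inr hxU)
      rcases hUH ⟨hxU, hGH hx⟩ with h | h
      · refine Or.inr (Or.inl (Or.inl (Or.inr ⟨0, ⟨le_rfl, hs₂.le⟩, ?_⟩)))
        rw [hra.2.2, mem_singleton_iff.1 h]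
      · obtain ⟨b, hb, hxb⟩ := mem_iUnion₂.1 h
        by_cases hba : b = a
        · subst hba
          obtain ⟨u, hu, rfl⟩ := hxb
          rcases le_total u s₂ with h | h
          · exact Or.inr (Or.inl (Or.inl (Or.inr ⟨u, ⟨hu.1, h⟩, rfl⟩)))
          rcases le_total u s₁ with h' | h'
          · exact Or.inl ⟨u, ⟨h, h'⟩, rfl⟩
          · exact Or.inr (Or.inl (Or.inr ⟨u, ⟨h', hu.2⟩, rfl⟩))
        · exact Or.inr (Or.inl (Or.inl (Or.inl (mem_biUnion ⟨hb, hba⟩ hxb))))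
    have hdisj : G ∩ (C ∩ D) = ∅ := by
      rw [eq_empty_iff_forall_notMem]
      rintro x ⟨hxG, ⟨u, hu, rfl⟩, hxD⟩
      have hu1 : u ∈ Icc (0 : ℝ) 1 := ⟨hs₂.le.trans hu.1, hu.2.trans hs₁1⟩
      rcases hxD with ((h | h) | h) | h
      · obtain ⟨b, hb, hxb⟩ := mem_iUnion₂.1 h
        have := hTp hb.1 ha hb.2 ⟨hxb, mem_image_of_mem a hu1⟩
        rw [mem_singleton_iff, ← hra.2.2] at this
        have := hra.2.1 hu1 (by simp) this
        linarith [hu.1]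
      · rw [hra.mem_image_Icc_iff le_rfl (hs₂t.trans (hts.le.trans hs₁1)) hu1] at h
        have : u = s₂ := le_antisymm h.2 hu.1
        exact hs₂G (this ▸ hxG)
      · rw [hra.mem_image_Icc_iff hs₁.le le_rfl hu1] at h
        have : u = s₁ := le_antisymm hu.2 h.1
        exact hs₁G (this ▸ hxG)
      · exact h (hs₀U ⟨u, ⟨hu1.1, hu.2.trans hs₁0⟩, rfl⟩)
    have hpD : p ∈ D := Or.inl (Or.inl (Or.inr ⟨0, ⟨le_rfl, hs₂.le⟩, hra.2.2⟩))
    have := isPreconnected_closed_iff.1 hG C D hCc hDc hcov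
      ⟨a t, htG, t, ⟨hs₂t, hts.le⟩, rfl⟩ ⟨p, hp, hpD⟩
    rw [hdisj] at this
    exact this.ne_empty rfl
  choose! s hs0 hs1 hs using key
  obtain ⟨V, hVU, hVo, hpV, hV⟩ :=
    exists_isOpen_avoiding_tails hTf (fun a ha => (hTr a ha).1) hs0 hU hpU
  refine ⟨(fun a t => a (s a * t)) '' {a ∈ T | a '' Icc 0 (s a) ⊆ G},
    ⟨(hTf.subset (sep_subset _ _)).image _, ?_, ?_⟩, V, hVo, hpV, ?_⟩
  · rintro _ ⟨a, ⟨ha, haG⟩, rfl⟩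
    refine ⟨(hTr a ha).1.comp_mul (hs0 a ha) (hs1 a ha), ?_⟩
    rwa [image_mul_left_Icc_zero_one a (hs0 a ha)]
  · rintro _ ⟨a, ⟨ha, -⟩, rfl⟩ _ ⟨b, ⟨hb, -⟩, rfl⟩ hab
    have hab' : a ≠ b := by rintro rfl; exact hab rfl
    rw [image_mul_left_Icc_zero_one a (hs0 a ha), image_mul_left_Icc_zero_one b (hs0 b hb)]
    exact (inter_subset_inter (image_mono (Icc_subset_Icc_right (hs1 a ha)))
      (image_mono (Icc_subset_Icc_right (hs1 b hb)))).trans (hTp ha hb hab')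
  · rintro x ⟨hxV, hxG⟩
    rcases hUH ⟨hVU hxV, hGH hxG⟩ with h | h
    · exact Or.inl h
    obtain ⟨a, ha, hxa⟩ := mem_iUnion₂.1 h
    obtain ⟨t, ht0, hts, ht1, rfl⟩ := mem_image_of_notMem_image_tail hxa (hV x hxV a ha)
    rcases ht0.eq_or_lt with h | h
    · left; rw [← h]; exact (hTr a ha).1.2.2
    right
    rcases hs a ha with h' | h'
    · refine mem_biUnion (mem_image_of_mem _ ⟨ha, h'⟩) ?_
      rw [image_mul_left_Icc_zero_one a (hs0 a ha)]
      exact ⟨t, ⟨ht0, hts.le⟩, rfl⟩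
    · exact absurd hxG (h' t h hts)

end

section

variable {X : Type*} [MetricSpace X] [CompactSpace X] {p : X}

/-- Two arcs from `p` that meet again have a common initial segment, unless there is a simple
closed curve. -/
theorem IsRay.image_Icc_subset_of_mem {a b : ℝ → X} {E : Set X}
    (hE : ∀ S ⊆ E, ¬ IsSimpleClosedCurve S) (ha : IsRay a p) (haE : a '' Icc 0 1 ⊆ E)
    (hb : IsRay b p) (hbE : b '' Icc 0 1 ⊆ E) {s : ℝ} (hs : s ∈ Icc (0 : ℝ) 1)
    (hsb : a s ∈ b '' Icc 0 1) : a '' Icc 0 s ⊆ b '' Icc 0 1 := by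
  rintro _ ⟨u, hu, rfl⟩
  by_contra hub
  set B := b '' Icc 0 1 with hB
  have hBc : IsClosed B := (hb.isCompact_image_Icc le_rfl le_rfl).isClosed
  have hu1 : u ≤ 1 := hu.2.trans hs.2
  obtain ⟨z, hzB, hz⟩ := ((ha.continuousOn_Icc le_rfl hu1).joinedIn_image_Icc
    (right_mem_Icc.2 hu.1) (left_mem_Icc.2 hu.1)).exists_first_hit hBc
    (by rw [ha.2.2]; exact hb.mem_image)
  obtain ⟨z', hzB', hz'⟩ := ((ha.continuousOn_Icc hu.1 hs.2).joinedIn_image_Icc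
    (left_mem_Icc.2 hu.2) (right_mem_Icc.2 hu.2)).exists_first_hit hBc hsb
  have hne : z ≠ z' := by
    rintro rfl
    obtain ⟨v, hv, rfl⟩ := hz.target_mem.1
    obtain ⟨v', hv', hvv⟩ := hz'.target_mem.1
    have hvv' := ha.2.1 ⟨hu.1.trans hv'.1, hv'.2.trans hs.2⟩ ⟨hv.1, hv.2.trans hu1⟩ hvv
    have : v = u := le_antisymm hv.2 (hvv' ▸ hv'.1)
    exact hub (this ▸ hzB)
  have h₁ : JoinedIn (E ∩ (Bᶜ ∪ {z, z'})) (a u) z := hz.mono <|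
    inter_subset_inter ((image_mono (Icc_subset_Icc_right hu1)).trans haE)
      (union_subset_union_right _ (by simp))
  have h₂ : JoinedIn (E ∩ (Bᶜ ∪ {z, z'})) (a u) z' := hz'.mono <|
    inter_subset_inter ((image_mono (Icc_subset_Icc hu.1 hs.2)).trans haE)
      (union_subset_union_right _ (by simp))
  obtain ⟨S, hSE, hS, -⟩ := exists_isSimpleClosedCurve_of_bridge hne (h₁.symm.trans h₂)
    ((hb.isArc.joinedIn_of_mem hzB hzB').mono (subset_inter hbE subset_rfl))
  exact hE S hSE hS

theorem exists_pairwise_subfamily {E : Set X}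
    (hE : ∀ S ⊆ E, ¬ IsSimpleClosedCurve S) {T₀ : Set (ℝ → X)} (hT₀ : T₀.Finite)
    (hr : ∀ a ∈ T₀, IsRay a p ∧ a '' Icc 0 1 ⊆ E) :
    ∃ T ⊆ T₀, (T.Pairwise fun a b => a '' Icc 0 1 ∩ b '' Icc 0 1 ⊆ {p}) ∧
      ∀ a ∈ T₀, ∃ s, 0 < s ∧ s ≤ 1 ∧ ∃ b ∈ T, a '' Icc 0 s ⊆ b '' Icc 0 1 := by
  induction T₀, hT₀ using Set.Finite.induction_on with
  | empty => exact ⟨∅, subset_rfl, pairwise_empty _, by simp⟩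
  | @insert a T₀ _ _ ih =>
    obtain ⟨T, hT, hTp, h⟩ := ih fun b hb => hr b (mem_insert_of_mem _ hb)
    by_cases hm : ∀ b ∈ T, a '' Icc 0 1 ∩ b '' Icc 0 1 ⊆ {p}
    · refine ⟨insert a T, insert_subset_insert hT, ?_, ?_⟩
      · refine hTp.insert fun b hb _ => ⟨hm b hb, ?_⟩
        rw [inter_comm]; exact hm b hb
      · rintro b (rfl | hb)
        · exact ⟨1, one_pos, le_rfl, b, mem_insert _ _, subset_rfl⟩
        · obtain ⟨s, hs, hs1, c, hc, hbc⟩ := h b hb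
          exact ⟨s, hs, hs1, c, mem_insert_of_mem _ hc, hbc⟩
    · push Not at hm
      obtain ⟨b, hb, hab⟩ := hm
      refine ⟨T, hT.trans (subset_insert _ _), hTp, ?_⟩
      rintro c (rfl | hc)
      · obtain ⟨x, ⟨⟨s, hs, rfl⟩, hxb⟩, hxp⟩ := not_subset.1 hab
        obtain ⟨ha, haE⟩ := hr c (mem_insert _ _)
        obtain ⟨hb', hbE⟩ := hr b (mem_insert_of_mem _ (hT hb))
        refine ⟨s, lt_of_le_of_ne hs.1 ?_, hs.2, b, hb,
          ha.image_Icc_subset_of_mem hE haE hb' hbE hs hxb⟩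
        rintro rfl
        exact hxp ha.2.2
      · exact h c hc

theorem starAt_of_rays {K E : Set X} (hE : ∀ S ⊆ E, ¬ IsSimpleClosedCurve S)
    {T₀ : Set (ℝ → X)} (hT₀ : T₀.Finite) (hr : ∀ a ∈ T₀, IsRay a p ∧ a '' Icc 0 1 ⊆ K ∩ E)
    {U : Set X} (hU : IsOpen U) (hp : p ∈ U)
    (hUK : U ∩ K ⊆ {p} ∪ ⋃ a ∈ T₀, a '' Icc 0 1) : StarAt K p := by
  obtain ⟨T, hT, hTp, h⟩ := exists_pairwise_subfamily hE hT₀ fun a ha =>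
    ⟨(hr a ha).1, (hr a ha).2.trans inter_subset_right⟩
  choose! s hs0 hs1 hs using h
  obtain ⟨V, hVU, hVo, hpV, hV⟩ :=
    exists_isOpen_avoiding_tails hT₀ (fun a ha => (hr a ha).1) hs0 hU hp
  refine ⟨T, ⟨hT₀.subset hT, fun a ha => ⟨(hr a (hT ha)).1,
    (hr a (hT ha)).2.trans inter_subset_left⟩, hTp⟩, V, hVo, hpV, ?_⟩
  rintro x ⟨hxV, hxK⟩
  rcases hUK ⟨hVU hxV, hxK⟩ with h | h
  · exact Or.inl h
  obtain ⟨a, ha, hxa⟩ := mem_iUnion₂.1 h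
  obtain ⟨t, ht0, hts, ht1, rfl⟩ := mem_image_of_notMem_image_tail hxa (hV x hxV a ha)
  obtain ⟨b, hb, hab⟩ := hs a ha
  exact Or.inr (mem_biUnion hb (hab ⟨t, ⟨ht0, hts.le⟩, rfl⟩))

/-- A finite union of small arcs and points is locally a star. -/
theorem starAt_of_finite_arcs {F : Set X} {𝒜 : Set (Set X)} (hF : F.Finite) (h𝒜 : 𝒜.Finite)
    (harc : ∀ A ∈ 𝒜, ∃ u v, IsArc A u v) {E : Set X} (hE : ∀ S ⊆ E, ¬ IsSimpleClosedCurve S)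
    (hAE : ∀ A ∈ 𝒜, p ∈ A → A ⊆ E) : StarAt (F ∪ ⋃₀ 𝒜) p := by
  have h : ∀ A ∈ 𝒜, ∃ T : Set (ℝ → X), T.Finite ∧ (∀ a ∈ T, IsRay a p ∧ a '' Icc 0 1 ⊆ A ∩ E) ∧
      (p ∈ A → A ⊆ {p} ∪ ⋃ a ∈ T, a '' Icc 0 1) := by
    intro A hA
    by_cases hp : p ∈ A
    · obtain ⟨u, v, huv⟩ := harc A hA
      obtain ⟨T, hT, hAT⟩ := huv.exists_isStarFamily hp
      exact ⟨T, hT.1, fun a ha => ⟨(hT.2.1 a ha).1,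
        subset_inter (hT.2.1 a ha).2 ((hT.2.1 a ha).2.trans (hAE A hA hp))⟩, fun _ => hAT⟩
    · exact ⟨∅, finite_empty, by simp, fun h => absurd h hp⟩
  choose! T hTf hTr hTc using h
  have hC : IsClosed ((F \ {p}) ∪ ⋃₀ {A ∈ 𝒜 | p ∉ A}) := by
    refine (hF.subset sdiff_subset).isClosed.union ?_
    rw [sUnion_eq_biUnion]
    refine (h𝒜.subset (sep_subset _ _)).isClosed_biUnion fun A hA => ?_
    obtain ⟨u, v, h⟩ := harc A hA.1
    exact h.isCompact.isClosed
  refine starAt_of_rays hE (h𝒜.biUnion hTf) ?_ hC.isOpen_compl (p := p) ?_ ?_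
  · intro a ha
    obtain ⟨A, hA, haA⟩ := mem_iUnion₂.1 ha
    refine ⟨(hTr A hA a haA).1, (hTr A hA a haA).2.trans (inter_subset_inter_left _ ?_)⟩
    exact (subset_sUnion_of_mem hA).trans subset_union_right
  · rintro (h | ⟨A, hA, hpA⟩)
    · exact h.2 rfl
    · exact hA.2 hpA
  · rintro x ⟨hx, hxF | ⟨A, hA, hxA⟩⟩
    · by_cases h : x = p
      · exact Or.inl h
      · exact absurd (Or.inl ⟨hxF, h⟩) hx
    · by_cases hp : p ∈ A
      · rcases hTc A hA hp hxA with h | h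
        · exact Or.inl h
        · obtain ⟨a, ha, hxa⟩ := mem_iUnion₂.1 h
          exact Or.inr (mem_biUnion (mem_biUnion hA ha) hxa)
      · exact absurd (Or.inr ⟨A, ⟨hA, hp⟩, hxA⟩) hx

theorem IsPreconnected.joinedIn_of_starAt {X : Type*} [TopologicalSpace X] {K : Set X} (hK : IsPreconnected K)
    (hs : ∀ p ∈ K, StarAt K p) {x y : X} (hx : x ∈ K) (hy : y ∈ K) : JoinedIn K x y := by
  refine hK.induction₂' (fun x y => JoinedIn K x y) (fun z hz => ?_)
    (fun a b c _ _ _ h k => h.trans k) hx hy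
  obtain ⟨T, hT, U, hU, hzU, hUK⟩ := hs z hz
  filter_upwards [inter_mem_nhdsWithin K (hU.mem_nhds hzU)] with w hw
  suffices JoinedIn K z w from ⟨this, this.symm⟩
  rcases hUK hw.symm with h | h
  · rw [mem_singleton_iff.1 h]; exact .refl hz
  · obtain ⟨a, ha, hwa⟩ := mem_iUnion₂.1 h
    exact ((hT.2.1 a ha).1.isArc.joinedIn_of_mem (hT.2.1 a ha).1.mem_image hwa).mono
      (hT.2.1 a ha).2

end

section

variable {X : Type*} [MetricSpace X] [CompactSpace X] [LocallyConnectedSpace X] [ConnectedSpace X]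

theorem joinedIn_univ_of_locallyConnected (x y : X) : JoinedIn univ x y := by
  obtain ⟨δ, hδ, h⟩ := exists_joinedIn_ball_of_dist_lt (X := X) one_pos
  refine isPreconnected_univ.induction₂' (fun x y => JoinedIn univ x y) (fun z _ => ?_)
    (fun a b c _ _ _ h k => h.trans k) (mem_univ x) (mem_univ y)
  filter_upwards [mem_nhdsWithin_of_mem_nhds (ball_mem_nhds z hδ)] with w hw
  have := (h z w (mem_ball'.1 hw)).mono (subset_univ _)
  exact ⟨this, this.symm⟩

/-- If small sets contain no simple closed curve, all of them lie in a common finite graph. -/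
theorem exists_graph_containing_simpleClosedCurves {ε : ℝ} (hε : 0 < ε)
    (hsmall : ∀ x : X, ∀ S ⊆ ball x ε, ¬ IsSimpleClosedCurve S) :
    ∃ H : Set X, IsClosed H ∧ H.Nonempty ∧ IsPreconnected H ∧ (∀ p ∈ H, StarAt H p) ∧
      ∀ S : Set X, IsSimpleClosedCurve S → S ⊆ H := by
  obtain ⟨α, hα, hαj⟩ := exists_joinedIn_ball_of_dist_lt (X := X) (show 0 < ε / 8 by linarith)
  obtain ⟨η, hη, hηα, hηε⟩ : ∃ η : ℝ, 0 < η ∧ 8 * η ≤ α ∧ 32 * η ≤ ε :=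
    ⟨min (α / 8) (ε / 32), by positivity, by linarith [min_le_left (α / 8) (ε / 32)],
      by linarith [min_le_right (α / 8) (ε / 32)]⟩
  obtain ⟨δ', hδ', hδj⟩ := exists_joinedIn_ball_of_dist_lt (X := X) hη
  obtain ⟨δ, hδ, hδδ', hδη⟩ : ∃ δ : ℝ, 0 < δ ∧ 3 * δ ≤ δ' ∧ δ ≤ η :=
    ⟨min (δ' / 3) η, by positivity, by linarith [min_le_left (δ' / 3) η], min_le_right _ _⟩
  obtain ⟨F, hF, hFn⟩ :=
    Metric.totallyBounded_iff.1 (isCompact_univ (X := X)).totallyBounded δ hδ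
  have hnet : ∀ x : X, ∃ a ∈ F, dist x a < δ := fun x => by
    simpa using hFn (mem_univ x)
  have harc : ∀ q : X × X, ∃ A : Set X, q.1 ≠ q.2 → dist q.1 q.2 < 3 * δ →
      A ⊆ ball q.1 η ∧ IsArc A q.1 q.2 := by
    intro q
    by_cases h : q.1 ≠ q.2 ∧ dist q.1 q.2 < 3 * δ
    · obtain ⟨A, hA, hA'⟩ := (hδj q.1 q.2 (h.2.trans_le hδδ')).exists_isArc h.1
      exact ⟨A, fun _ _ => ⟨hA, hA'⟩⟩
    · exact ⟨∅, fun h1 h2 => absurd ⟨h1, h2⟩ h⟩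
  choose A hA using harc
  let 𝒜 : Set (Set X) := A '' {q ∈ F ×ˢ F | q.1 ≠ q.2 ∧ dist q.1 q.2 < 3 * δ}
  have h𝒜 : 𝒜.Finite := ((hF.prod hF).subset (sep_subset _ _)).image _
  let H := F ∪ ⋃₀ 𝒜
  have hFH : F ⊆ H := subset_union_left
  have hAH : ∀ a ∈ F, ∀ b ∈ F, a ≠ b → dist a b < 3 * δ → A (a, b) ⊆ H :=
    fun a ha b hb hab hd => (subset_sUnion_of_mem
      (show A (a, b) ∈ 𝒜 from ⟨(a, b), ⟨⟨ha, hb⟩, hab, hd⟩, rfl⟩)).trans subset_union_right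
  have hHF : ∀ x ∈ H, ∃ a ∈ F, JoinedIn (H ∩ ball a η) a x := by
    rintro x (hx | ⟨_, ⟨q, ⟨⟨ha, hb⟩, hq1, hq2⟩, rfl⟩, hx⟩)
    · exact ⟨x, hx, .refl ⟨hFH hx, mem_ball_self hη⟩⟩
    · obtain ⟨h1, h2⟩ := hA q hq1 hq2
      exact ⟨q.1, ha, (h2.joinedIn_of_mem h2.left_mem hx).mono
        (subset_inter (hAH _ ha _ hb hq1 hq2) h1)⟩
  have hchain : ∀ (E : Set X) (x y : X), JoinedIn E x y → ∀ a ∈ F, ∀ b ∈ F, dist x a < δ →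
      dist y b < δ → JoinedIn (H ∩ {w | ∃ z ∈ E, dist w z < 2 * η}) a b := by
    intro E x y h
    obtain ⟨P, hPE, hP, hxP, hyP⟩ := h.isPreconnected_superset
    refine hP.induction₂' (fun x y => ∀ a ∈ F, ∀ b ∈ F, dist x a < δ → dist y b < δ →
      JoinedIn (H ∩ {w | ∃ z ∈ E, dist w z < 2 * η}) a b) (fun z hz => ?_) ?_ hxP hyP
    · have key : ∀ w, dist w z < δ → ∀ a ∈ F, ∀ b ∈ F, dist z a < δ → dist w b < δ →
          JoinedIn (H ∩ {w | ∃ z ∈ E, dist w z < 2 * η}) a b := by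
        intro w hw a ha b hb hza hwb
        have hab : dist a b < 3 * δ := by
          have := dist_triangle4 a z w b
          rw [dist_comm a z, dist_comm z w] at this
          linarith
        by_cases hne : a = b
        · subst hne
          exact .refl ⟨hFH ha, z, hPE hz, by rw [dist_comm]; linarith⟩
        · obtain ⟨h1, h2⟩ := hA (a, b) hne hab
          refine h2.joinedIn.mono (subset_inter (hAH a ha b hb hne hab) fun v hv => ?_)
          refine ⟨z, hPE hz, ?_⟩
          have h3 := mem_ball.1 (h1 hv)
          have := dist_triangle_right v z a
          linarith
      filter_upwards [mem_nhdsWithin_of_mem_nhds (ball_mem_nhds z hδ)] with w hw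
      exact ⟨key w hw, fun a ha b hb h1 h2 => (key w hw b hb a ha h2 h1).symm⟩
    · intro u v w _ _ _ h1 h2 a ha b hb hu hw
      obtain ⟨c, hc, hvc⟩ := hnet v
      exact (h1 a ha c hc hu hvc).trans (h2 c hc b hb hvc hw)
  have hHj : ∀ x ∈ H, ∀ y ∈ H, dist x y < 4 * η → JoinedIn (H ∩ ball x (ε / 2)) x y := by
    intro x hx y hy hxy
    obtain ⟨a, ha, hax⟩ := hHF x hx
    obtain ⟨b, hb, hby⟩ := hHF y hy
    have hxa := mem_ball.1 hax.target_mem.2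
    have hyb := mem_ball'.1 hby.target_mem.2
    have hxb : dist b x < 5 * η := by
      have := dist_triangle_right b x y
      linarith
    have hab : dist a b < α := by
      have := dist_triangle_right a b x
      rw [dist_comm a x] at this
      linarith
    have h := hchain _ a b (hαj a b hab) a ha b hb (by rwa [dist_self]) (by rwa [dist_self])
    refine ((hax.symm.mono ?_).trans (h.mono ?_)).trans (hby.mono ?_)
    · exact inter_subset_inter_right _ (ball_subset_ball' (by rw [dist_comm]; linarith))
    · refine inter_subset_inter_right _ ?_
      rintro w ⟨z, hz, hwz⟩
      have h1 := mem_ball.1 hz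
      have h2 := dist_triangle4 w z a x
      rw [dist_comm a x] at h2
      exact mem_ball.2 (by linarith)
    · exact inter_subset_inter_right _ (ball_subset_ball' (by linarith))
  have hHc : IsClosed H := by
    refine hF.isClosed.union ?_
    rw [sUnion_eq_biUnion]
    refine h𝒜.isClosed_biUnion ?_
    rintro _ ⟨q, ⟨-, hq⟩, rfl⟩
    exact (hA q hq.1 hq.2).2.isCompact.isClosed
  have hHconn : ∀ x ∈ H, ∀ y ∈ H, JoinedIn H x y := by
    intro x hx y hy
    obtain ⟨a, ha, hax⟩ := hHF x hx
    obtain ⟨b, hb, hby⟩ := hHF y hy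
    have h := hchain _ a b (joinedIn_univ_of_locallyConnected a b) a ha b hb
      (by rwa [dist_self]) (by rwa [dist_self])
    exact ((hax.symm.mono inter_subset_left).trans (h.mono inter_subset_left)).trans
      (hby.mono inter_subset_left)
  obtain ⟨x₀⟩ := ‹ConnectedSpace X›.toNonempty
  obtain ⟨a₀, ha₀, -⟩ := hnet x₀
  have hHn : H.Nonempty := ⟨a₀, hFH ha₀⟩
  refine ⟨H, hHc, hHn, ?_, fun p _ => ?_, fun S hS => ?_⟩
  · exact (isPathConnected_iff.2 ⟨hHn, hHconn⟩).isConnected.isPreconnected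
  · refine starAt_of_finite_arcs hF h𝒜 ?_ (hsmall p) ?_
    · rintro _ ⟨q, ⟨-, hq⟩, rfl⟩
      exact ⟨_, _, (hA q hq.1 hq.2).2⟩
    · rintro _ ⟨q, ⟨-, hq⟩, rfl⟩ hp
      have h1 := (hA q hq.1 hq.2).1
      exact h1.trans (ball_subset_ball' (by linarith [mem_ball'.1 (h1 hp)]))
  · obtain ⟨r, hr, hrK, hrj, hru, hrl⟩ := exists_first_hit_retraction hHc hη (fun x => by
      obtain ⟨a, ha, hxa⟩ := hnet x
      exact ⟨a, hFH ha, hδj x a (by linarith)⟩) (by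
      intro z h hh h' hh' hj
      by_contra hne
      have h1 := mem_ball.1 hj.source_mem.1
      have h2 := mem_ball.1 hj.target_mem.1
      have hd : dist h h' < 4 * η := by linarith [dist_triangle_right h h' z]
      obtain ⟨S, hSE, hS, -⟩ := exists_isSimpleClosedCurve_of_bridge (E := ball h ε) hne
        (hj.mono (inter_subset_inter_left _ (ball_subset_ball' (by
          rw [dist_comm]; linarith))))
        ((hHj h hh h' hh' hd).mono (by
          rw [inter_comm]; exact inter_subset_inter_left _ (ball_subset_ball (by linarith))))
      exact hsmall h S hSE hS)
    refine hS.subset_of_retraction hHc hr (η := η) hrK (fun x hx => ?_) (fun x => ?_) hrl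
      fun x hx => hsmall x S (hx.trans (ball_subset_ball (by linarith))) hS
    · exact (hru x x hx (.refl ⟨mem_ball_self hη, Or.inr rfl⟩)).symm
    · exact mem_ball'.1 (hrj x).target_mem.1

end

section

variable {X : Type*} [TopologicalSpace X]

theorem IsLocalDendrite.locallyConnectedSpace (hX : IsLocalDendrite X) :
    LocallyConnectedSpace X := by
  rw [locallyConnectedSpace_iff_connected_subsets]
  intro x U hU
  obtain ⟨N, hN, -, hlc, -⟩ := hX.2 x
  obtain ⟨V, hV, hVc, hVU⟩ := locallyConnectedSpace_iff_connected_subsets.1 hlc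
    ⟨x, mem_of_mem_nhds hN⟩ (Subtype.val ⁻¹' U) (continuous_subtype_val.continuousAt hU)
  refine ⟨Subtype.val '' V, ?_, hVc.image _ continuous_subtype_val.continuousOn,
    image_subset_iff.2 hVU⟩
  rw [← map_nhds_subtype_coe_eq_nhds (mem_of_mem_nhds hN) hN]
  exact Filter.image_mem_map hV

theorem IsSimpleClosedCurve.preimage_val {S N : Set X} (hS : IsSimpleClosedCurve S)
    (hSN : S ⊆ N) : IsSimpleClosedCurve (Subtype.val ⁻¹' S : Set N) := by
  obtain ⟨e⟩ := hS
  have h := (IsEmbedding.subtypeVal (p := (· ∈ N))).homeomorphImage (Subtype.val ⁻¹' S : Set N)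
  have hi : Subtype.val '' (Subtype.val ⁻¹' S : Set N) = S := by
    rw [Subtype.image_preimage_coe, inter_eq_right.2 hSN]
  exact ⟨h.trans ((Homeomorph.setCongr hi).trans e)⟩

/-- `K` is a path connected closed set containing `G` that is locally a star. -/
structure IsGraphOver (G K : Set X) : Prop where
  subset : G ⊆ K
  isClosed : IsClosed K
  joinedIn : ∀ x ∈ K, ∀ y ∈ K, JoinedIn K x y
  starAt : ∀ p ∈ K, StarAt K p

/-- `r x` is the first point of `K` on every path from `x` to `K`. -/
structure IsFirstHit (K : Set X) (r : X → X) : Prop where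
  continuous : Continuous r
  mem : ∀ x, r x ∈ K
  joinedIn : ∀ x, JoinedIn (Kᶜ ∪ {r x}) x (r x)
  eq : ∀ x, ∀ h ∈ K, JoinedIn (Kᶜ ∪ {h}) x h → h = r x

theorem IsFirstHit.apply_of_mem {K : Set X} {r : X → X} (hr : IsFirstHit K r) {x : X}
    (hx : x ∈ K) : r x = x :=
  (hr.eq x x hx (.refl (Or.inr rfl))).symm

theorem IsFirstHit.mem_of_joinedIn {K E : Set X} {r : X → X} (hr : IsFirstHit K r)
    (hK : IsClosed K) {x y : X} (hy : y ∈ K) (h : JoinedIn E x y) : r x ∈ E := by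
  obtain ⟨z, hz, h⟩ := h.exists_first_hit hK hy
  rw [← hr.eq x z hz (h.mono inter_subset_right)]
  exact h.target_mem.1

theorem StarAt.union_of_inter_subset [T2Space X] {K A : Set X} {p q : X} (hK : StarAt K p)
    (hA : IsArc A p q) (hKA : A ∩ K ⊆ {p}) : StarAt (K ∪ A) p := by
  obtain ⟨T, ⟨hTf, hTr, hTp⟩, U, hU, hpU, hUK⟩ := hK
  obtain ⟨a, ha, -, rfl⟩ := hA.exists_isRay
  refine ⟨insert a T, ⟨hTf.insert a, ?_, ?_⟩, U, hU, hpU, ?_⟩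
  · rintro b (rfl | hb)
    · exact ⟨ha, subset_union_right⟩
    · exact ⟨(hTr b hb).1, (hTr b hb).2.trans subset_union_left⟩
  · refine hTp.insert fun b hb _ => ⟨?_, ?_⟩
    · exact (inter_subset_inter_right _ (hTr b hb).2).trans hKA
    · rw [inter_comm]; exact (inter_subset_inter_right _ (hTr b hb).2).trans hKA
  · rw [biUnion_insert]
    rintro x ⟨hxU, hxK | hxA⟩
    · rcases hUK ⟨hxU, hxK⟩ with h | h
      exacts [Or.inl h, Or.inr (Or.inr h)]
    · exact Or.inr (Or.inl hxA)

theorem StarAt.union_of_notMem {K A : Set X} {p : X} (hK : StarAt K p) (hA : IsClosed A)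
    (hp : p ∉ A) : StarAt (K ∪ A) p := by
  obtain ⟨T, ⟨hTf, hTr, hTp⟩, U, hU, hpU, hUK⟩ := hK
  refine ⟨T, ⟨hTf, fun b hb => ⟨(hTr b hb).1, (hTr b hb).2.trans subset_union_left⟩, hTp⟩,
    U \ A, hU.sdiff hA, ⟨hpU, hp⟩, ?_⟩
  rintro x ⟨hxU, hxK | hxA⟩
  · exact hUK ⟨hxU.1, hxK⟩
  · exact absurd hxA hxU.2

theorem IsArc.starAt {A : Set X} {u v p : X} (h : IsArc A u v) (hp : p ∈ A) : StarAt A p := by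
  obtain ⟨T, hT, hAT⟩ := h.exists_isStarFamily hp
  exact ⟨T, hT, univ, isOpen_univ, mem_univ p, inter_subset_right.trans hAT⟩

theorem IsGraphOver.union_arc [T2Space X] {G K A : Set X} {p q : X} (hK : IsGraphOver G K)
    (hp : p ∈ K) (hA : IsArc A p q) (hKA : A ∩ K ⊆ {p}) : IsGraphOver G (K ∪ A) where
  subset := hK.subset.trans subset_union_left
  isClosed := hK.isClosed.union hA.isCompact.isClosed
  joinedIn := by
    have key : ∀ x ∈ K ∪ A, JoinedIn (K ∪ A) p x := by
      rintro x (hx | hx)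
      · exact (hK.joinedIn p hp x hx).mono subset_union_left
      · exact (hA.joinedIn_of_mem hA.left_mem hx).mono subset_union_right
    exact fun x hx y hy => (key x hx).symm.trans (key y hy)
  starAt := by
    intro z hz
    by_cases hzA : z ∈ A
    · by_cases hzK : z ∈ K
      · obtain rfl := hKA ⟨hzA, hzK⟩
        exact (hK.starAt _ hzK).union_of_inter_subset hA hKA
      · rw [union_comm]
        exact (hA.starAt hzA).union_of_notMem hK.isClosed hzK
    · exact (hK.starAt z (hz.resolve_right hzA)).union_of_notMem hA.isCompact.isClosed hzA

end

section

variable {X : Type*} [MetricSpace X]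

theorem IsLocalDendrite.exists_ball_not_isSimpleClosedCurve (hX : IsLocalDendrite X) :
    ∃ ε > 0, ∀ x : X, ∀ S ⊆ ball x ε, ¬ IsSimpleClosedCurve S := by
  have : CompactSpace X := hX.1.2.1
  choose N hN hNd using hX.2
  obtain ⟨ε, hε, h⟩ := lebesgue_number_lemma_of_metric (isCompact_univ (X := X))
    (fun x => isOpen_interior (s := N x))
    (fun x _ => mem_iUnion.2 ⟨x, mem_interior_iff_mem_nhds.2 (hN x)⟩)
  refine ⟨ε, hε, fun x S hS hscc => ?_⟩
  obtain ⟨i, hi⟩ := h x (mem_univ x)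
  exact (hNd i).2.2 _ (hscc.preimage_val (hS.trans (hi.trans interior_subset)))

variable [CompactSpace X] [LocallyConnectedSpace X] [ConnectedSpace X]

theorem IsGraphOver.exists_isFirstHit {G K : Set X} (hK : IsGraphOver G K) (hKn : K.Nonempty)
    (hG : ∀ S : Set X, IsSimpleClosedCurve S → S ⊆ G) : ∃ r, IsFirstHit K r := by
  obtain ⟨y, hy⟩ := hKn
  have hb : Bornology.IsBounded (univ : Set X) := isCompact_univ.isBounded
  obtain ⟨C, hC⟩ := Metric.isBounded_iff.1 hb
  have hball : ∀ x, ∀ η, C < η → ball x η = univ := fun x η h =>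
    eq_univ_of_forall fun z => mem_ball.2 ((hC (mem_univ z) (mem_univ x)).trans_lt h)
  have hC0 : 0 ≤ C := dist_nonneg.trans (hC (mem_univ y) (mem_univ y))
  have h1 : ∀ x, ball x (C + 1) = univ := fun x => hball x _ (by linarith)
  have h2 : ∀ x, ball x (2 * (C + 1)) = univ := fun x => hball x _ (by linarith)
  obtain ⟨r, hr, hrK, hrj, hru, -⟩ := exists_first_hit_retraction hK.isClosed
    (show 0 < C + 1 by linarith)
    (fun x => ⟨y, hy, by rw [h1]; exact joinedIn_univ_of_locallyConnected x y⟩)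
    (by
      intro z h hh h' hh' hj
      by_contra hne
      rw [h2] at hj
      obtain ⟨S, -, hS, hSK⟩ := exists_isSimpleClosedCurve_of_bridge hne hj
        (by rw [univ_inter]; exact hK.joinedIn h hh h' hh')
      exact hSK ((hG S hS).trans hK.subset))
  simp only [h1, univ_inter] at hrj hru
  exact ⟨r, hr, hrK, hrj, hru⟩

theorem IsCoreSkeleton.isGraphOver (hX : IsLocalDendrite X) {G : Set X} (hG : IsCoreSkeleton G) :
    IsGraphOver G G := by
  obtain ⟨ε, hε, hsmall⟩ := hX.exists_ball_not_isSimpleClosedCurve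
  obtain ⟨H, hHc, hHn, hHp, hHs, hHS⟩ := exists_graph_containing_simpleClosedCurves hε hsmall
  obtain ⟨⟨hGn, hGcomp, hGconn, -⟩, -, hGmin⟩ := hG
  have hGp : IsPreconnected G :=
    isPreconnected_iff_preconnectedSpace.2 inferInstance
  have hGH : G ⊆ H := by
    refine hGmin H ⟨hHn.to_subtype, isCompact_iff_compactSpace.1 hHc.isCompact, ?_,
      inferInstance⟩ hHS
    exact isConnected_iff_connectedSpace.1 ⟨hHn, hHp⟩
  have hGs : ∀ p ∈ G, StarAt G p := fun p hp => (hHs p (hGH hp)).mono hGH hGp hp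
  exact ⟨subset_rfl, (isCompact_iff_compactSpace.2 hGcomp).isClosed,
    fun x hx y hy => hGp.joinedIn_of_starAt hGs hx hy, hGs⟩

end

theorem exists_direction_ne {D : Set (EuclideanSpace ℝ (Fin 2))} (hD : D.Finite) :
    ∃ w : EuclideanSpace ℝ (Fin 2), w ≠ 0 ∧ ∀ d ∈ D, d ≠ 0 → ∀ l : ℝ, l • w ≠ d := by
  obtain ⟨m, hm⟩ : ∃ m : ℕ, (m : ℝ) ∉ (fun d : EuclideanSpace ℝ (Fin 2) => d 1 / d 0) '' D := by
    by_contra! h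
    exact (infinite_range_of_injective (Nat.cast_injective (R := ℝ))) ((hD.image _).subset
      (range_subset_iff.2 h))
  refine ⟨!₂[1, (m : ℝ)], fun h => ?_, ?_⟩
  · have := congrArg (fun v : EuclideanSpace ℝ (Fin 2) => v 0) h
    simp at this
  · rintro _ hd hd0 l rfl
    have hl : l ≠ 0 := by rintro rfl; exact hd0 (zero_smul _ _)
    refine hm ⟨_, hd, ?_⟩
    simp [hl]

section

variable {X : Type*} [TopologicalSpace X] [T2Space X] {Y : Type*} [TopologicalSpace Y]

theorem continuousOn_image_of_comp {a : ℝ → X} {g : X → Y} {s : Set ℝ} (hs : IsCompact s)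
    (ha : ContinuousOn a s) (hg : ContinuousOn (g ∘ a) s) : ContinuousOn g (a '' s) := by
  rw [continuousOn_iff_isClosed]
  intro F hF
  obtain ⟨C, hC, hCs⟩ := continuousOn_iff_isClosed.1 hg F hF
  refine ⟨a '' (C ∩ s), ((hs.inter_left hC).image_of_continuousOn
    (ha.mono inter_subset_right)).isClosed, ?_⟩
  ext x
  constructor
  · rintro ⟨hx, t, ht, rfl⟩
    have : t ∈ g ∘ a ⁻¹' F ∩ s := ⟨hx, ht⟩
    rw [hCs] at this
    exact ⟨mem_image_of_mem a this, mem_image_of_mem a ht⟩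
  · rintro ⟨⟨t, ht, rfl⟩, hx⟩
    rw [← hCs] at ht
    exact ⟨ht.1, hx⟩

end

section

variable {X : Type*} [TopologicalSpace X] [T2Space X]

/-- An embedding in the plane can be modified slightly so that a given point of the image, at
which the set is a star, becomes an endpoint of a segment meeting the image only there. -/
theorem StarAt.exists_accessible_embedding {K : Set X} (hK : IsCompact K) {p : X} (hp : p ∈ K)
    (hs : StarAt K p) {f : X → EuclideanSpace ℝ (Fin 2)} (hf : ContinuousOn f K)
    (hi : InjOn f K) {ρ : ℝ} (hρ : 0 < ρ) :
    ∃ g : X → EuclideanSpace ℝ (Fin 2), ContinuousOn g K ∧ InjOn g K ∧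
      (∀ x ∈ K, dist (g x) (f x) < ρ) ∧ g p = f p ∧
      ∃ v : EuclideanSpace ℝ (Fin 2), v ≠ 0 ∧ ‖v‖ < ρ ∧
        ∀ s : ℝ, 0 < s → s ≤ 1 → f p + s • v ∉ g '' K := by
  classical
  obtain ⟨T, ⟨hTf, hTr, hTp⟩, U, hU, hpU, hUK⟩ := hs
  have hTK : ∀ a ∈ T, ∀ t ∈ Icc (0 : ℝ) 1, a t ∈ K := fun a ha t ht =>
    (hTr a ha).2 (mem_image_of_mem a ht)
  have hray : ∀ a ∈ T, IsRay a p := fun a ha => (hTr a ha).1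
  have hsame : ∀ a ∈ T, ∀ b ∈ T, ∀ t ∈ Icc (0 : ℝ) 1, ∀ u ∈ Icc (0 : ℝ) 1, a t = b u →
      0 < t → a = b ∧ t = u := by
    intro a ha b hb t ht u hu htu h0
    by_cases hab : a = b
    · subst hab
      exact ⟨rfl, (hray a ha).2.1 ht hu htu⟩
    · have h1 : a t = p := hTp ha hb hab ⟨mem_image_of_mem a ht, htu ▸ mem_image_of_mem b hu⟩
      rw [← (hray a ha).2.2] at h1
      exact absurd ((hray a ha).2.1 ht (by simp) h1) h0.ne'
  have hfa : ∀ a ∈ T, ContinuousOn (fun t => f (a t)) (Icc 0 1) := fun a ha =>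
    hf.comp (hray a ha).1 (hTK a ha)
  have hη : ∀ a ∈ T, ∃ η, 0 < η ∧ η ≤ 1 ∧
      ∀ t ∈ Icc 0 η, a t ∈ U ∧ dist (f (a t)) (f p) < ρ / 2 := by
    intro a ha
    have h1 : ∀ᶠ t in 𝓝[Icc 0 1] (0 : ℝ), a t ∈ U :=
      (hray a ha).1 0 (by simp) (hU.mem_nhds (by rwa [(hray a ha).2.2]))
    have h2 : ∀ᶠ t in 𝓝[Icc 0 1] (0 : ℝ), f (a t) ∈ ball (f p) (ρ / 2) :=
      hfa a ha 0 (by simp) (isOpen_ball.mem_nhds (by simp [(hray a ha).2.2, hρ]))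
    have := h1.and h2
    rw [eventually_nhdsWithin_iff, Metric.eventually_nhds_iff] at this
    obtain ⟨e, he, h⟩ := this
    refine ⟨min (e / 2) 1, by positivity, min_le_right _ _, fun t ht => ?_⟩
    refine h ?_ ⟨ht.1, ht.2.trans (min_le_right _ _)⟩
    rw [Real.dist_eq, sub_zero, abs_of_nonneg ht.1]
    exact (ht.2.trans (min_le_left _ _)).trans_lt (by linarith)
  choose! η hη0 hη1 hηU using hη
  obtain ⟨r, hr0, hrρ, hrU, hrη⟩ : ∃ r, 0 < r ∧ r < ρ / 2 ∧ (∀ x ∈ K \ U, r < dist (f x) (f p)) ∧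
      ∀ a ∈ T, ∀ t ∈ Icc (η a) 1, r < dist (f (a t)) (f p) := by
    have hc : IsCompact ((K \ U) ∪ ⋃ a ∈ T, a '' Icc (η a) 1) :=
      (hK.diff hU).union (hTf.isCompact_biUnion fun a ha =>
        (hray a ha).isCompact_image_Icc (hη0 a ha).le le_rfl)
    have hsub : (K \ U) ∪ ⋃ a ∈ T, a '' Icc (η a) 1 ⊆ K := by
      refine union_subset sdiff_subset (iUnion₂_subset fun a ha => ?_)
      exact (image_mono (Icc_subset_Icc_left (hη0 a ha).le)).trans (hTr a ha).2
    have hcf := (hc.image_of_continuousOn (hf.mono hsub)).isClosed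
    have hpn : f p ∉ f '' ((K \ U) ∪ ⋃ a ∈ T, a '' Icc (η a) 1) := by
      rintro ⟨x, hx, hxp⟩
      obtain rfl := hi (hsub hx) hp hxp
      rcases hx with h | h
      · exact h.2 hpU
      · obtain ⟨a, ha, h⟩ := mem_iUnion₂.1 h
        exact (hray a ha).notMem_image_Icc (hη0 a ha) h
    obtain ⟨e, he, hball⟩ := Metric.isOpen_iff.1 hcf.isOpen_compl _ hpn
    have key : ∀ x ∈ (K \ U) ∪ ⋃ a ∈ T, a '' Icc (η a) 1, min (e / 2) (ρ / 4) < dist (f x) (f p) := by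
      intro x hx
      by_contra! h
      exact hball (mem_ball.2 (h.trans_lt ((min_le_left _ _).trans_lt (by linarith))))
        (mem_image_of_mem f hx)
    exact ⟨min (e / 2) (ρ / 4), by positivity, (min_le_right _ _).trans_lt (by linarith),
      fun x hx => key x (Or.inl hx), fun a ha t ht =>
      key _ (Or.inr (mem_biUnion ha (mem_image_of_mem a ht)))⟩
  have hlast : ∀ a ∈ T, ∃ t, 0 < t ∧ t < η a ∧ dist (f (a t)) (f p) = r ∧
      ∀ u ∈ Icc (0 : ℝ) 1, t < u → r < dist (f (a u)) (f p) := by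
    intro a ha
    have hd : ContinuousOn (fun t => dist (f (a t)) (f p)) (Icc 0 1) :=
      continuous_dist.comp_continuousOn ((hfa a ha).prodMk continuousOn_const)
    have hc : IsCompact (Icc (0 : ℝ) 1 ∩ (fun t => dist (f (a t)) (f p)) ⁻¹' Iic r) :=
      isCompact_Icc.of_isClosed_subset (hd.preimage_isClosed_of_isClosed isClosed_Icc isClosed_Iic)
        inter_subset_left
    obtain ⟨t, ⟨ht, htr⟩, hmax⟩ := hc.exists_isGreatest
      ⟨0, by simp, by simp [(hray a ha).2.2, hr0.le]⟩
    have htη : t < η a := by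
      by_contra! h
      exact not_le.2 (hrη a ha t ⟨h, ht.2⟩) htr
    have hgt : ∀ u ∈ Icc (0 : ℝ) 1, t < u → r < dist (f (a u)) (f p) := by
      intro u hu htu
      by_contra! h
      exact absurd (hmax ⟨hu, h⟩) (not_le.2 htu)
    have heq : dist (f (a t)) (f p) = r := by
      refine le_antisymm htr ?_
      by_contra! hlt
      have hev : ∀ᶠ u in 𝓝[Icc 0 1] t, dist (f (a u)) (f p) < r := hd t ht (Iio_mem_nhds hlt)
      rw [eventually_nhdsWithin_iff, Metric.eventually_nhds_iff] at hev
      obtain ⟨e, he, h⟩ := hev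
      have ht1 : t < 1 := htη.trans_le (hη1 a ha)
      have hu : min (t + e / 2) 1 ∈ Icc (0 : ℝ) 1 :=
        ⟨le_min (by linarith [ht.1]) zero_le_one, min_le_right _ _⟩
      have htu : t < min (t + e / 2) 1 := lt_min (by linarith) ht1
      refine absurd (hgt _ hu htu) (not_lt.2 (h ?_ hu).le)
      rw [Real.dist_eq, abs_of_pos (by linarith)]
      linarith [min_le_left (t + e / 2) 1]
    refine ⟨t, lt_of_le_of_ne ht.1 ?_, htη, heq, hgt⟩
    rintro rfl
    rw [(hray a ha).2.2, dist_self] at heq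
    exact hr0.ne heq
  choose! τ hτ0 hτη hτr hτgt using hlast
  have hτ1 : ∀ a ∈ T, τ a ≤ 1 := fun a ha => (hτη a ha).le.trans (hη1 a ha)
  have hI : ∀ a ∈ T, ∀ t ∈ Icc 0 (τ a), t ∈ Icc (0 : ℝ) 1 := fun a ha t ht =>
    ⟨ht.1, ht.2.trans (hτ1 a ha)⟩
  let d : (ℝ → X) → EuclideanSpace ℝ (Fin 2) := fun a => f (a (τ a)) - f p
  have hd : ∀ a ∈ T, ‖d a‖ = r := fun a ha => by rw [← hτr a ha, dist_eq_norm]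
  let P : X → (ℝ → X) × ℝ → Prop := fun x q => q.1 ∈ T ∧ q.2 ∈ Icc 0 (τ q.1) ∧ q.1 q.2 = x
  let g : X → EuclideanSpace ℝ (Fin 2) := fun x =>
    if h : ∃ q, P x q then f p + (h.choose.2 / τ h.choose.1) • d h.choose.1 else f x
  have hg : ∀ a ∈ T, ∀ t ∈ Icc 0 (τ a), g (a t) = f p + (t / τ a) • d a := by
    intro a ha t ht
    have h : ∃ q, P (a t) q := ⟨(a, t), ha, ht, rfl⟩
    change (if h : ∃ q, P (a t) q then _ else _) = _
    rw [dif_pos h]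
    have hspec := h.choose_spec
    generalize h.choose = q at hspec ⊢
    obtain ⟨b, u⟩ := q
    obtain ⟨hb, hu, hbu⟩ := hspec
    dsimp only at hb hu hbu ⊢
    rcases ht.1.eq_or_lt with h0 | h0
    · rcases hu.1.eq_or_lt with hu0 | hu0
      · rw [← h0, ← hu0]; simp
      · have := (hsame _ hb a ha _ (hI _ hb _ hu) t (hI a ha t ht) hbu hu0).2
        rw [← h0] at this
        exact absurd this hu0.ne'
    · obtain ⟨rfl, rfl⟩ := hsame a ha _ hb t (hI a ha t ht) _ (hI _ hb _ hu) hbu.symm h0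
      rfl
  have hgn : ∀ a ∈ T, ∀ t ∈ Icc 0 (τ a), dist (g (a t)) (f p) = t / τ a * r := by
    intro a ha t ht
    rw [hg a ha t ht, dist_eq_norm, add_sub_cancel_left, norm_smul, hd a ha, Real.norm_eq_abs,
      abs_of_nonneg (div_nonneg ht.1 (hτ0 a ha).le)]
  have hgp : g p = f p := by
    by_cases h : T.Nonempty
    · obtain ⟨a, ha⟩ := h
      have := hg a ha 0 ⟨le_rfl, (hτ0 a ha).le⟩
      rwa [(hray a ha).2.2, zero_div, zero_smul, add_zero] at this
    · exact dif_neg fun ⟨q, hq, _⟩ => h ⟨q.1, hq⟩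
  let C : Set X := (K \ U) ∪ ⋃ a ∈ T, a '' Icc (τ a) 1
  have hCc : IsClosed C := (hK.diff hU).isClosed.union (hTf.isClosed_biUnion fun a ha =>
    ((hray a ha).isCompact_image_Icc (hτ0 a ha).le le_rfl).isClosed)
  have hCK : C ⊆ K := union_subset sdiff_subset (iUnion₂_subset fun a ha =>
    (image_mono (Icc_subset_Icc_left (hτ0 a ha).le)).trans (hTr a ha).2)
  have hgC : ∀ x ∈ C, g x = f x := by
    intro x hx
    by_cases h : ∃ q, P x q
    · obtain ⟨⟨b, u⟩, hb, hu, rfl⟩ := h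
      dsimp only at hb hu hx ⊢
      rcases hx with hx | hx
      · exact absurd (hηU b hb u ⟨hu.1, hu.2.trans (hτη b hb).le⟩).1 hx.2
      · obtain ⟨a, ha, w, hw, hwx⟩ := mem_iUnion₂.1 hx
        obtain ⟨rfl, rfl⟩ := hsame a ha b hb w ⟨(hτ0 a ha).le.trans hw.1, hw.2⟩ u
          (hI b hb u hu) hwx ((hτ0 a ha).trans_le hw.1)
        obtain rfl : w = τ a := le_antisymm hu.2 hw.1
        rw [hg a ha _ hu, div_self (hτ0 a ha).ne', one_smul, add_sub_cancel]
    · exact dif_neg h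
  have hCr : ∀ x ∈ C, r ≤ dist (g x) (f p) := by
    intro x hx
    rw [hgC x hx]
    rcases hx with hx | hx
    · exact (hrU x hx).le
    · obtain ⟨a, ha, w, hw, rfl⟩ := mem_iUnion₂.1 hx
      rcases hw.1.eq_or_lt with h | h
      · rw [← h, hτr a ha]
      · exact (hτgt a ha w ⟨(hτ0 a ha).le.trans hw.1, hw.2⟩ h).le
  have hcases : ∀ x ∈ K, x ∈ C ∨ x = p ∨ ∃ a ∈ T, ∃ t, 0 < t ∧ t < τ a ∧ a t = x := by
    intro x hx
    by_cases hxU : x ∈ U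
    swap
    · exact Or.inl (Or.inl ⟨hx, hxU⟩)
    rcases hUK ⟨hxU, hx⟩ with h | h
    · exact Or.inr (Or.inl h)
    obtain ⟨a, ha, t, ht, rfl⟩ := mem_iUnion₂.1 h
    rcases le_or_gt (τ a) t with h | h
    · exact Or.inl (Or.inr (mem_biUnion ha ⟨t, ⟨h, ht.2⟩, rfl⟩))
    rcases ht.1.eq_or_lt with h0 | h0
    · rw [← h0]; exact Or.inr (Or.inl (hray a ha).2.2)
    · exact Or.inr (Or.inr ⟨a, ha, t, h0, h, rfl⟩)
  have hmid : ∀ a ∈ T, ∀ t, 0 < t → t < τ a →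
      0 < dist (g (a t)) (f p) ∧ dist (g (a t)) (f p) < r := by
    intro a ha t h0 ht
    rw [hgn a ha t ⟨h0.le, ht.le⟩]
    have h1 : t / τ a < 1 := (div_lt_one (hτ0 a ha)).2 ht
    have h2 : 0 < t / τ a := div_pos h0 (hτ0 a ha)
    exact ⟨mul_pos h2 hr0, by nlinarith⟩
  refine ⟨g, ?_, ?_, ?_, hgp, ?_⟩
  · have hcov : K ⊆ C ∪ ({p} ∪ ⋃ a : T, a.1 '' Icc 0 (τ a.1)) := by
      intro x hx
      rcases hcases x hx with h | h | ⟨a, ha, t, h0, ht, rfl⟩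
      · exact Or.inl h
      · exact Or.inr (Or.inl h)
      · exact Or.inr (Or.inr (mem_iUnion.2 ⟨⟨a, ha⟩, t, ⟨h0.le, ht.le⟩, rfl⟩))
    have : Finite T := hTf
    have hcl : ∀ a : T, IsClosed (a.1 '' Icc 0 (τ a.1)) := fun a =>
      ((hray a a.2).isCompact_image_Icc le_rfl (hτ1 a a.2)).isClosed
    refine ContinuousOn.mono ?_ hcov
    refine ContinuousOn.union_of_isClosed ((hf.mono hCK).congr hgC)
      (ContinuousOn.union_of_isClosed (continuousOn_singleton _ _)
        ((locallyFinite_of_finite _).continuousOn_iUnion hcl fun a => ?_)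
        isClosed_singleton (isClosed_iUnion_of_finite hcl)) hCc
      (isClosed_singleton.union (isClosed_iUnion_of_finite hcl))
    refine continuousOn_image_of_comp isCompact_Icc
      ((hray a a.2).continuousOn_Icc le_rfl (hτ1 a a.2)) ?_
    refine ContinuousOn.congr (f := fun t => f p + (t / τ a.1) • d a.1) ?_
      fun t ht => hg a.1 a.2 t ht
    fun_prop
  · intro x hx y hy hxy
    rcases hcases x hx with h | rfl | ⟨a, ha, t, ht0, ht, rfl⟩ <;>
      rcases hcases y hy with k | rfl | ⟨b, hb, u, hu0, hu, rfl⟩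
    · exact hi hx hy (by rwa [← hgC x h, ← hgC y k])
    · have := hCr x h
      rw [hxy, hgp, dist_self] at this
      exact absurd hr0 (not_lt.2 this)
    · have := hCr x h
      rw [hxy] at this
      exact absurd (hmid b hb u hu0 hu).2 (not_lt.2 this)
    · have := hCr y k
      rw [← hxy, hgp, dist_self] at this
      exact absurd hr0 (not_lt.2 this)
    · rfl
    · have := (hmid b hb u hu0 hu).1
      rw [← hxy, hgp, dist_self] at this
      exact absurd this (lt_irrefl _)
    · have := hCr y k
      rw [← hxy] at this
      exact absurd (hmid a ha t ht0 ht).2 (not_lt.2 this)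
    · have := (hmid a ha t ht0 ht).1
      rw [hxy, hgp, dist_self] at this
      exact absurd this (lt_irrefl _)
    · have hn := congrArg (fun z => dist z (f p)) hxy
      rw [hgn a ha t ⟨ht0.le, ht.le⟩, hgn b hb u ⟨hu0.le, hu.le⟩] at hn
      have hq := mul_right_cancel₀ hr0.ne' hn
      rw [hg a ha t ⟨ht0.le, ht.le⟩, hg b hb u ⟨hu0.le, hu.le⟩, ← hq] at hxy
      have hdd : d a = d b :=
        smul_right_injective _ (div_pos ht0 (hτ0 a ha)).ne' (add_left_cancel hxy)
      have hfeq : f (a (τ a)) = f (b (τ b)) := sub_left_injective hdd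
      have hta : τ a ∈ Icc (0 : ℝ) 1 := ⟨(hτ0 a ha).le, hτ1 a ha⟩
      have htb : τ b ∈ Icc (0 : ℝ) 1 := ⟨(hτ0 b hb).le, hτ1 b hb⟩
      obtain ⟨rfl, -⟩ := hsame a ha b hb _ hta _ htb
        (hi (hTK a ha _ hta) (hTK b hb _ htb) hfeq) (hτ0 a ha)
      rw [div_left_inj' (hτ0 a ha).ne'] at hq
      rw [hq]
  · intro x hx
    rcases hcases x hx with h | rfl | ⟨a, ha, t, ht0, ht, rfl⟩
    · rw [hgC x h, dist_self]; exact hρ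
    · rw [hgp, dist_self]; exact hρ
    · have h1 := (hmid a ha t ht0 ht).2
      have h2 := (hηU a ha t ⟨ht0.le, ht.le.trans (hτη a ha).le⟩).2
      linarith [dist_triangle_right (g (a t)) (f (a t)) (f p)]
  · obtain ⟨w, hw0, hw⟩ := exists_direction_ne (hTf.image d)
    have hwn : 0 < ‖w‖ := norm_pos_iff.2 hw0
    have hvn : ‖(r / (2 * ‖w‖)) • w‖ = r / 2 := by
      rw [norm_smul, Real.norm_eq_abs, abs_of_pos (by positivity)]
      field_simp
    refine ⟨(r / (2 * ‖w‖)) • w, smul_ne_zero (by positivity) hw0, by rw [hvn]; linarith, ?_⟩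
    rintro s hs0 hs1 ⟨x, hx, hxs⟩
    have hdist : dist (g x) (f p) = s * (r / 2) := by
      rw [hxs, dist_eq_norm, add_sub_cancel_left, norm_smul, hvn, Real.norm_eq_abs,
        abs_of_pos hs0]
    rcases hcases x hx with h | rfl | ⟨a, ha, t, ht0, ht, rfl⟩
    · have := hCr x h
      rw [hdist] at this
      nlinarith
    · rw [hgp, dist_self] at hdist
      have : 0 < s * (r / 2) := by positivity
      linarith
    · rw [hg a ha t ⟨ht0.le, ht.le⟩] at hxs
      have h1 := add_left_cancel hxs
      have hq : t / τ a ≠ 0 := (div_pos ht0 (hτ0 a ha)).ne'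
      refine hw (d a) (mem_image_of_mem d ha) ?_ ((t / τ a)⁻¹ * (s * (r / (2 * ‖w‖)))) ?_
      · rw [← norm_pos_iff, hd a ha]; exact hr0
      · rw [mul_smul, mul_smul, ← h1, inv_smul_smul₀ hq]

end

section

variable {X : Type*} [TopologicalSpace X]

/-- `F` embeds the graph `K` in the plane and factors through the retraction `r` onto `K`. -/
structure IsGraphEmbedding (G K : Set X) (r : X → X) (F : C(X, EuclideanSpace ℝ (Fin 2))) :
    Prop where
  isGraphOver : IsGraphOver G K
  isFirstHit : IsFirstHit K r
  apply_eq : ∀ x, F (r x) = F x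
  injOn : InjOn F K

theorem StarAt.exists_extension_arc [T2Space X] {K A : Set X} {p q : X} (hK : IsCompact K)
    (hp : p ∈ K) (hs : StarAt K p) {f : X → EuclideanSpace ℝ (Fin 2)} (hf : ContinuousOn f K)
    (hi : InjOn f K) (hA : IsArc A p q) (hKA : A ∩ K ⊆ {p}) {ρ : ℝ} (hρ : 0 < ρ) :
    ∃ g : X → EuclideanSpace ℝ (Fin 2), ContinuousOn g (K ∪ A) ∧ InjOn g (K ∪ A) ∧
      (∀ x ∈ K, dist (g x) (f x) < ρ) ∧ ∀ x ∈ A, dist (g x) (f p) < ρ := by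
  classical
  obtain ⟨g, hgc, hgi, hgd, hgp, v, hv, hvρ, hvg⟩ :=
    hs.exists_accessible_embedding hK hp hf hi hρ
  obtain ⟨a, hac, hai, rfl, rfl, rfl⟩ := hA
  let φ : X → EuclideanSpace ℝ (Fin 2) := fun x =>
    if x ∈ K then g x else f (a 0) + Function.invFunOn a (Icc (0 : ℝ) 1) x • v
  have hφK : ∀ x ∈ K, φ x = g x := fun x hx => if_pos hx
  have hφA : ∀ t ∈ Icc (0 : ℝ) 1, φ (a t) = f (a 0) + t • v := by
    intro t ht
    by_cases h : a t ∈ K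
    · have h0 : a t = a 0 := hKA ⟨mem_image_of_mem a ht, h⟩
      obtain rfl := hai ht (by simp) h0
      rw [hφK _ h, hgp, zero_smul, add_zero]
    · refine (if_neg h).trans ?_
      rw [hai.leftInvOn_invFunOn ht]
  have hsep : ∀ x ∈ K, ∀ t ∈ Icc (0 : ℝ) 1, φ x = φ (a t) → x = a t := by
    intro x hx t ht h
    rw [hφA t ht] at h
    rcases ht.1.eq_or_lt with rfl | h0
    · rw [zero_smul, add_zero, hφK x hx, ← hgp] at h
      exact hgi hx hp h
    · rw [hφK x hx] at h
      exact absurd ⟨x, hx, h⟩ (hvg t h0 ht.2)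
  refine ⟨φ, ?_, ?_, ?_, ?_⟩
  · refine ContinuousOn.union_of_isClosed (hgc.congr hφK)
      (continuousOn_image_of_comp isCompact_Icc hac ?_) hK.isClosed
      (isCompact_Icc.image_of_continuousOn hac).isClosed
    refine ContinuousOn.congr (f := fun t : ℝ => f (a 0) + t • v) ?_ hφA
    fun_prop
  · rintro x (hx | ⟨t, ht, rfl⟩) y (hy | ⟨u, hu, rfl⟩) h
    · rw [hφK x hx, hφK y hy] at h
      exact hgi hx hy h
    · exact hsep x hx u hu h
    · exact (hsep y hy t ht h.symm).symm
    · rw [hφA t ht, hφA u hu] at h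
      rw [smul_left_injective ℝ hv (add_left_cancel h)]
  · intro x hx
    rw [hφK x hx]
    exact hgd x hx
  · rintro _ ⟨t, ht, rfl⟩
    rw [hφA t ht, dist_eq_norm, add_sub_cancel_left, norm_smul, Real.norm_eq_abs,
      abs_of_nonneg ht.1]
    exact (mul_le_of_le_one_left (norm_nonneg v) ht.2).trans_lt hvρ

end


theorem isOpen_setOfPred_small_fibers {X V : Type*} [MetricSpace X] [CompactSpace X]
    [MetricSpace V] (ε : ℝ) : IsOpen {F : C(X, V) | ∀ x y, F x = F y → dist x y < ε} := by
  have hc : IsCompact {q : X × X | ε ≤ dist q.1 q.2} :=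
    (isClosed_le continuous_const continuous_dist).isCompact
  rw [isOpen_iff_eventually]
  intro F hF
  have hev : ∀ᶠ F' : C(X, V) in 𝓝 F, ∀ q ∈ {q : X × X | ε ≤ dist q.1 q.2}, F' q.1 ≠ F' q.2 := by
    refine hc.eventually_forall_of_forall_eventually fun q hq => ?_
    have hne : F q.1 ≠ F q.2 := fun h => not_lt.2 hq (hF _ _ h)
    have ho : IsOpen {z : C(X, V) × (X × X) | z.1 z.2.1 ≠ z.1 z.2.2} :=
      isOpen_ne_fun (by fun_prop) (by fun_prop)
    exact ho.mem_nhds hne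
  filter_upwards [hev] with F' h x y hxy
  by_contra! hd
  exact h (x, y) hd hxy

section

variable {X : Type*} [MetricSpace X] [CompactSpace X] [LocallyConnectedSpace X] [ConnectedSpace X]
  {G : Set X}

theorem IsGraphEmbedding.exists_insert (hG : ∀ S : Set X, IsSimpleClosedCurve S → S ⊆ G)
    {K : Set X} {r : X → X} {F : C(X, EuclideanSpace ℝ (Fin 2))} (h : IsGraphEmbedding G K r F)
    (x₀ : X) {ρ : ℝ} (hρ : 0 < ρ) :
    ∃ K' r' F', IsGraphEmbedding G K' r' F' ∧ K ⊆ K' ∧ x₀ ∈ K' ∧ ∀ x, dist (F' x) (F x) < ρ := by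
  obtain ⟨hK, hr, hFr, hFi⟩ := h
  by_cases hx₀ : x₀ ∈ K
  · exact ⟨K, r, F, ⟨hK, hr, hFr, hFi⟩, subset_rfl, hx₀, fun x => by rwa [dist_self]⟩
  have hp := hr.mem x₀
  obtain ⟨A, hAs, hA⟩ := (hr.joinedIn x₀).symm.exists_isArc (by rintro h; exact hx₀ (h ▸ hp))
  have hAK : A ∩ K ⊆ {r x₀} := fun z hz => (hAs hz.1).resolve_left (not_not.2 hz.2)
  obtain ⟨g, hgc, hgi, hgK, hgA⟩ := (hK.starAt _ hp).exists_extension_arc hK.isClosed.isCompact hp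
    F.continuous.continuousOn hFi hA hAK hρ
  have hK' := hK.union_arc hp hA hAK
  obtain ⟨r', hr'⟩ := hK'.exists_isFirstHit ⟨_, Or.inl hp⟩ hG
  have hrr : ∀ x, r' x ∈ K → r' x = r x := fun x hx => hr.eq x _ hx
    ((hr'.joinedIn x).mono (union_subset_union_left _ (compl_subset_compl.2 subset_union_left)))
  have hrA : ∀ x, r' x ∈ A → r x = r x₀ := by
    intro x hx
    by_cases hxK : r' x ∈ K
    · rw [← hrr x hxK]
      exact hAK ⟨hx, hxK⟩
    · refine (hr.eq x _ hp (JoinedIn.trans ((hr'.joinedIn x).mono ?_)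
        ((hA.joinedIn_of_mem hx hA.left_mem).mono hAs))).symm
      rintro z (hz | rfl)
      · exact Or.inl fun hzK => hz (Or.inl hzK)
      · exact Or.inl hxK
  refine ⟨K ∪ A, r', ⟨fun x => g (r' x), hgc.comp_continuous hr'.continuous hr'.mem⟩,
    ⟨hK', hr', fun x => ?_, fun x hx y hy hxy => ?_⟩, subset_union_left, Or.inr hA.right_mem,
    fun x => ?_⟩
  · exact congrArg g (hr'.apply_of_mem (hr'.mem x))
  · change g (r' x) = g (r' y) at hxy
    rw [hr'.apply_of_mem hx, hr'.apply_of_mem hy] at hxy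
    exact hgi hx hy hxy
  · change dist (g (r' x)) (F x) < ρ
    rcases hr'.mem x with hx | hx
    · rw [← hFr x, ← hrr x hx]
      exact hgK _ hx
    · rw [← hFr x, hrA x hx]
      exact hgA _ hx

theorem IsGraphEmbedding.exists_union_finite (hG : ∀ S : Set X, IsSimpleClosedCurve S → S ⊆ G)
    {K : Set X} {r : X → X} {F : C(X, EuclideanSpace ℝ (Fin 2))} (h : IsGraphEmbedding G K r F)
    {t : Set X} (ht : t.Finite) : ∀ ρ > 0,
    ∃ K' r' F', IsGraphEmbedding G K' r' F' ∧ t ⊆ K' ∧ ∀ x, dist (F' x) (F x) < ρ := by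
  induction t, ht using Set.Finite.induction_on with
  | empty => exact fun ρ hρ => ⟨K, r, F, h, empty_subset _, fun x => by rwa [dist_self]⟩
  | @insert y t _ _ ih =>
    intro ρ hρ
    obtain ⟨K₁, r₁, F₁, h₁, ht₁, hd₁⟩ := ih (ρ / 2) (by positivity)
    obtain ⟨K₂, r₂, F₂, h₂, hK₂, hy, hd₂⟩ := h₁.exists_insert hG y (half_pos hρ)
    refine ⟨K₂, r₂, F₂, h₂, insert_subset hy (ht₁.trans hK₂), fun x => ?_⟩
    linarith [dist_triangle (F₂ x) (F₁ x) (F x), hd₁ x, hd₂ x]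

theorem IsGraphEmbedding.exists_small_fibers (hG : ∀ S : Set X, IsSimpleClosedCurve S → S ⊆ G)
    {K : Set X} {r : X → X} {F : C(X, EuclideanSpace ℝ (Fin 2))} (h : IsGraphEmbedding G K r F)
    {ε ρ : ℝ} (hε : 0 < ε) (hρ : 0 < ρ) :
    ∃ K' r' F', IsGraphEmbedding G K' r' F' ∧ (∀ x, dist (F' x) (F x) < ρ) ∧
      ∀ x y, F' x = F' y → dist x y < ε := by
  obtain ⟨δ, hδ, hj⟩ := exists_joinedIn_ball_of_dist_lt (X := X) (half_pos hε)
  obtain ⟨t, -, ht, hcov⟩ := finite_cover_balls_of_compact (isCompact_univ (X := X)) hδ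
  obtain ⟨K', r', F', h', htK, hd⟩ := h.exists_union_finite hG ht ρ hρ
  have hr : ∀ x, dist (r' x) x < ε / 2 := by
    intro x
    obtain ⟨y, hy, hxy⟩ := mem_iUnion₂.1 (hcov (mem_univ x))
    exact h'.isFirstHit.mem_of_joinedIn h'.isGraphOver.isClosed (htK hy) (hj x y hxy)
  refine ⟨K', r', F', h', hd, fun x y hxy => ?_⟩
  have : r' x = r' y := by
    refine h'.injOn (h'.isFirstHit.mem x) (h'.isFirstHit.mem y) ?_
    rw [h'.apply_eq, h'.apply_eq, hxy]
  have hx := hr x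
  rw [this] at hx
  linarith [dist_triangle_left x y (r' y), hr y]

theorem IsGraphEmbedding.exists_injective (hG : ∀ S : Set X, IsSimpleClosedCurve S → S ⊆ G)
    {K : Set X} {r : X → X} {F : C(X, EuclideanSpace ℝ (Fin 2))} (h : IsGraphEmbedding G K r F) :
    ∃ F' : C(X, EuclideanSpace ℝ (Fin 2)), Function.Injective F' := by
  let E : Set C(X, EuclideanSpace ℝ (Fin 2)) := {F | ∃ K r, IsGraphEmbedding G K r F}
  have : CompleteSpace (closure E) := isClosed_closure.completeSpace_coe
  let U : ℕ → Set (closure E) := fun n => {F | ∀ x y, F.1 x = F.1 y → dist x y < 1 / ((n : ℝ) + 1)}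
  have hU : ∀ n, IsOpen (U n) := fun n =>
    (isOpen_setOfPred_small_fibers (1 / ((n : ℝ) + 1))).preimage continuous_subtype_val
  have hd : ∀ n, Dense (U n) := by
    intro n
    rw [Metric.dense_iff]
    rintro ⟨F₀, hF₀⟩ ρ hρ
    obtain ⟨F₁, ⟨K₁, r₁, h₁⟩, hd₁⟩ := Metric.mem_closure_iff.1 hF₀ (ρ / 2) (half_pos hρ)
    obtain ⟨K₂, r₂, F₂, h₂, hd₂, hf⟩ := h₁.exists_small_fibers hG
      (ε := 1 / ((n : ℝ) + 1)) (by positivity) (half_pos hρ)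
    refine ⟨⟨F₂, subset_closure ⟨K₂, r₂, h₂⟩⟩, ?_, hf⟩
    rw [mem_ball, Subtype.dist_eq]
    have := (ContinuousMap.dist_lt_iff (half_pos hρ)).2 hd₂
    change dist F₂ F₀ < ρ
    linarith [dist_triangle_right F₂ F₀ F₁]
  have : Nonempty (closure E) := ⟨⟨F, subset_closure ⟨K, r, h⟩⟩⟩
  obtain ⟨F', hF'⟩ := (dense_iInter_of_isOpen_nat hU hd).nonempty
  refine ⟨F'.1, fun x y hxy => ?_⟩
  by_contra hne
  obtain ⟨n, hn⟩ := exists_nat_one_div_lt (dist_pos.2 hne)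
  exact absurd (mem_iInter.1 hF' n x y hxy) (not_lt.2 hn.le)

end

theorem IsCoreSkeleton.exists_isEmbedding {X : Type*} [TopologicalSpace X] (hX : IsLocalDendrite X)
    {G : Set X} (hG : IsCoreSkeleton G) {f : G → EuclideanSpace ℝ (Fin 2)} (hf : IsEmbedding f) :
    ∃ f : X → EuclideanSpace ℝ (Fin 2), IsEmbedding f := by
  obtain ⟨-, _, _, _⟩ := hX.1
  let _ : MetricSpace X := TopologicalSpace.metrizableSpaceMetric X
  have := hX.locallyConnectedSpace
  have hGG := hG.isGraphOver hX
  obtain ⟨r, hr⟩ := hGG.exists_isFirstHit (nonempty_coe_sort.1 hG.1.1) hG.2.1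
  have h : IsGraphEmbedding G G r
      ⟨fun x => f ⟨r x, hr.mem x⟩, hf.continuous.comp (hr.continuous.subtype_mk _)⟩ := by
    refine ⟨hGG, hr, fun x => ?_, fun x hx y hy hxy => ?_⟩
    · simp [hr.apply_of_mem (hr.mem x)]
    · have := congrArg Subtype.val (hf.injective hxy)
      dsimp only at this
      rwa [hr.apply_of_mem hx, hr.apply_of_mem hy] at this
  obtain ⟨F, hF⟩ := h.exists_injective hG.2.1
  exact ⟨F, (F.continuous.isClosedEmbedding hF).isEmbedding⟩

end

/-- A local dendrite containing a simple closed curve embeds in ℝ² iff its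
core skeleton embeds in ℝ². -/
theorem local_dendrite_embeds_in_plane_iff_core_skeleton_does
    {X : Type u} [TopologicalSpace X] (hX : IsLocalDendrite X)
    (hscc : ∃ S : Set X, IsSimpleClosedCurve S)
    (G : Set X) (hG : IsCoreSkeleton G) :
    (∃ f : X → EuclideanSpace ℝ (Fin 2), Topology.IsEmbedding f) ↔
    (∃ f : G → EuclideanSpace ℝ (Fin 2), Topology.IsEmbedding f) := by
  refine ⟨fun ⟨f, hf⟩ => ⟨f ∘ Subtype.val, hf.comp IsEmbedding.subtypeVal⟩, ?_⟩
  rintro ⟨f, hf⟩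
  exact hG.exists_isEmbedding hX hf
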